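/- Let T₁, T₂ be minimal actions of G on ℝ-trees with non-empty core, and let Ĉ be the augmented core. Endow Ĉ with the path metric induced by the ℓ²-product metric d((a₁,a₂),(b₁,b₂)) = √(d_{T₁}(a₁,b₁)² + d_{T₂}(a₂,b₂)²) on T₁ × T₂. Then Ĉ is a CAT(0) space. -/

import Mathlib

/-!
Formalization of definitions from V. Guirardel,
"Core and intersection number for group actions on trees".
-/

open Set Metric Filter Function Topology
open scoped ENNReal Pointwise

noncomputable section

namespace Guirardel

/-- The metric segment `[x,y]`: the set of points lying metrically between `x` and `y`.
In an `ℝ`-tree this is the image of the geodesic from `x` to `y`. -/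
def seg {T : Type*} [MetricSpace T] (x y : T) : Set T :=
  {p : T | dist x p + dist p y = dist x y}

/-- The open segment `]x,y[`. -/
def openSeg {T : Type*} [MetricSpace T] (x y : T) : Set T :=
  seg x y \ {x, y}

/-- A subset of an `ℝ`-tree is convex (i.e. a subtree when nonempty) if it contains the
segment between any two of its points. -/
def TreeConvex {T : Type*} [MetricSpace T] (S : Set T) : Prop :=
  ∀ x ∈ S, ∀ y ∈ S, seg x y ⊆ S

/-- An `ℝ`-tree: any two points are joined by a geodesic, and any two injective paths
with the same endpoints have the same image (uniqueness of arcs). -/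
structure IsRTree (T : Type*) [MetricSpace T] : Prop where
  exists_geod : ∀ x y : T, ∃ f : ℝ → T, f 0 = x ∧ f (dist x y) = y ∧
    ∀ s ∈ Icc (0 : ℝ) (dist x y), ∀ t ∈ Icc (0 : ℝ) (dist x y),
      dist (f s) (f t) = |s - t|
  arc_unique : ∀ (x y : T) (γ₁ γ₂ : Path x y),
    Function.Injective γ₁ → Function.Injective γ₂ →
      Set.range γ₁ = Set.range γ₂

/-- A direction based at `x`: a connected component of the complement of `x`. -/
def IsDirectionAt {T : Type*} [MetricSpace T] (δ : Set T) (x : T) : Prop :=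
  ∃ y : T, y ≠ x ∧ δ = connectedComponentIn {x}ᶜ y

/-- A direction in a tree. -/
def IsDirection {T : Type*} [MetricSpace T] (δ : Set T) : Prop :=
  ∃ x : T, IsDirectionAt δ x

/-- A branch point: a point with at least three directions. -/
def IsBranchPoint {T : Type*} [MetricSpace T] (x : T) : Prop :=
  ∃ δ₁ δ₂ δ₃ : Set T, IsDirectionAt δ₁ x ∧ IsDirectionAt δ₂ x ∧ IsDirectionAt δ₃ x ∧
    δ₁ ≠ δ₂ ∧ δ₁ ≠ δ₃ ∧ δ₂ ≠ δ₃

/-- A quadrant in `T₁ × T₂`: a product of two directions. -/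
def IsQuadrant {T₁ T₂ : Type*} [MetricSpace T₁] [MetricSpace T₂]
    (Q : Set (T₁ × T₂)) : Prop :=
  ∃ (δ₁ : Set T₁) (δ₂ : Set T₂), IsDirection δ₁ ∧ IsDirection δ₂ ∧ Q = δ₁ ×ˢ δ₂

/-- A quadrant is heavy if (for every choice of base point, which does not matter) there
is a sequence of orbit points inside it whose two coordinates go to infinity. -/
def Heavy (G : Type*) {T₁ T₂ : Type*} [Group G] [MetricSpace T₁] [MetricSpace T₂]
    [MulAction G T₁] [MulAction G T₂] (Q : Set (T₁ × T₂)) : Prop :=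
  ∀ p : T₁ × T₂, ∃ γ : ℕ → G,
    (∀ k, ((γ k • p.1 : T₁), (γ k • p.2 : T₂)) ∈ Q) ∧
    Tendsto (fun k => dist (γ k • p.1) p.1) atTop atTop ∧
    Tendsto (fun k => dist (γ k • p.2) p.2) atTop atTop

/-- The core of `T₁ × T₂`: the complement of the union of all light (i.e. non-heavy)
quadrants; equivalently the set of points all of whose quadrants are heavy. -/
def Core (G T₁ T₂ : Type*) [Group G] [MetricSpace T₁] [MetricSpace T₂]
    [MulAction G T₁] [MulAction G T₂] : Set (T₁ × T₂) :=
  {z : T₁ × T₂ | ∀ Q : Set (T₁ × T₂), IsQuadrant Q → z ∈ Q → Heavy G Q}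

/-- A subset of `T₁ × T₂` has convex fibers if its horizontal and vertical fibers
are convex. -/
def ConvexFibers {T₁ T₂ : Type*} [MetricSpace T₁] [MetricSpace T₂]
    (E : Set (T₁ × T₂)) : Prop :=
  (∀ x₁ : T₁, TreeConvex {y₂ : T₂ | (x₁, y₂) ∈ E}) ∧
  (∀ x₂ : T₂, TreeConvex {y₁ : T₁ | (y₁, x₂) ∈ E})

/-- The action of `G` on `T` is by isometries. -/
def IsometricAction (G T : Type*) [MetricSpace T] [SMul G T] : Prop :=
  ∀ (g : G) (x y : T), dist (g • x) (g • y) = dist x y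

/-- `g` is elliptic: it fixes a point of `T`. -/
def Elliptic {G : Type*} (T : Type*) [SMul G T] (g : G) : Prop :=
  ∃ x : T, g • x = x

/-- `g` is hyperbolic: it fixes no point of `T`. -/
def Hyperbolic {G : Type*} (T : Type*) [SMul G T] (g : G) : Prop :=
  ∀ x : T, g • x ≠ x

/-- Translation length of `g` on `T`. -/
def translationLength {G : Type*} (T : Type*) [MetricSpace T] [SMul G T] (g : G) : ℝ :=
  ⨅ x : T, dist x (g • x)

/-- The axis (characteristic set) of `g`: points minimizing displacement. -/
def axisSet {G : Type*} (T : Type*) [MetricSpace T] [SMul G T] (g : G) : Set T :=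
  {x : T | ∀ y : T, dist x (g • x) ≤ dist y (g • y)}

/-- The action is non-trivial: some element is hyperbolic. -/
def NontrivialAction (G T : Type*) [SMul G T] : Prop :=
  ∃ g : G, ∀ x : T, g • x ≠ x

/-- The action is free: only the identity fixes a point. -/
def FreeAction (G T : Type*) [Group G] [MulAction G T] : Prop :=
  ∀ g : G, g ≠ 1 → ∀ x : T, g • x ≠ x

/-- The action is minimal: no proper nonempty invariant subtree. -/
def MinimalAction (G T : Type*) [MetricSpace T] [SMul G T] : Prop :=
  ∀ S : Set T, S.Nonempty → TreeConvex S → (∀ g : G, ∀ x ∈ S, g • x ∈ S) → S = univ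

/-- The minimal subtree for the subset `H` of `G`: the intersection of all nonempty
invariant subtrees. -/
def minSubtreeOf {G : Type*} (H : Set G) (T : Type*) [MetricSpace T] [SMul G T] : Set T :=
  ⋂₀ {S : Set T | S.Nonempty ∧ TreeConvex S ∧ ∀ g ∈ H, ∀ x ∈ S, g • x ∈ S}

/-- The minimal subtree of the `G`-action. -/
def minSubtree (G T : Type*) [MetricSpace T] [SMul G T] : Set T :=
  minSubtreeOf (univ : Set G) T

/-- A line in `T`: the image of an isometric embedding of `ℝ`. -/
def IsLine {T : Type*} [MetricSpace T] (L : Set T) : Prop :=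
  ∃ f : ℝ → T, (∀ s t : ℝ, dist (f s) (f t) = |s - t|) ∧ L = range f

/-- A ray in `T`: the image of an isometric embedding of `[0,∞)`. -/
def IsRay {T : Type*} [MetricSpace T] (R : Set T) : Prop :=
  ∃ f : ℝ → T, (∀ s ∈ Ici (0 : ℝ), ∀ t ∈ Ici (0 : ℝ), dist (f s) (f t) = |s - t|) ∧
    R = f '' Ici 0

/-- Two rays (or subsets) define the same end when they are at finite Hausdorff distance. -/
def SameEnd {T : Type*} [MetricSpace T] (R R' : Set T) : Prop :=
  EMetric.hausdorffEdist R R' ≠ ⊤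

/-- The action of `G` fixes an end of `T`. -/
def GFixedEnd (G T : Type*) [MetricSpace T] [SMul G T] : Prop :=
  ∃ R : Set T, IsRay R ∧ ∀ g : G, SameEnd ((fun x => g • x) '' R) R

/-- The action of `G` has an invariant line. -/
def GInvariantLine (G T : Type*) [MetricSpace T] [SMul G T] : Prop :=
  ∃ L : Set T, IsLine L ∧ ∀ g : G, (fun x => g • x) '' L = L

/-- The action is irreducible: no invariant line and no fixed end. -/
def IrreducibleAction (G T : Type*) [MetricSpace T] [SMul G T] : Prop :=
  ¬ GInvariantLine G T ∧ ¬ GFixedEnd G T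

/-- The action is dihedral: there is an invariant line on which some element acts as a
reflection (i.e. with non-constant displacement along the line). -/
def DihedralAction (G T : Type*) [MetricSpace T] [SMul G T] : Prop :=
  ∃ L : Set T, IsLine L ∧ (∀ g : G, (fun x => g • x) '' L = L) ∧
    ∃ g : G, ∃ x ∈ L, ∃ y ∈ L, dist x (g • x) ≠ dist y (g • y)

/-- `A` is a positive semi-axis of `g`: a ray contained in the axis of `g` and mapped
into itself by `g`. -/
def PosSemiAxis {G : Type*} (T : Type*) [MetricSpace T] [SMul G T] (g : G) (A : Set T) :
    Prop :=
  IsRay A ∧ A ⊆ axisSet T g ∧ (fun x => g • x) '' A ⊆ A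

/-- `g` translates towards the end determined by the ray `R`:
`g` is hyperbolic and has a positive semi-axis defining the same end as `R`. -/
def TranslatesToward {G : Type*} (T : Type*) [MetricSpace T] [SMul G T] (g : G)
    (R : Set T) : Prop :=
  Hyperbolic T g ∧ ∃ A : Set T, PosSemiAxis T g A ∧ SameEnd A R

/-- The end `ω_T(g)` of the hyperbolic element `g` lies in the set of ends of `δ`:
some positive semi-axis of `g` is contained in `δ`. -/
def EndInSubtree {G : Type*} (T : Type*) [MetricSpace T] [SMul G T] (g : G)
    (δ : Set T) : Prop :=
  ∃ A : Set T, PosSemiAxis T g A ∧ A ⊆ δ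

/-- A map between `ℝ`-trees preserves alignment if the image of a point between `y`
and `z` lies between the images of `y` and `z`. -/
def AlignPreserving {T T' : Type*} [MetricSpace T] [MetricSpace T'] (f : T → T') : Prop :=
  ∀ x y z : T, x ∈ seg y z → f x ∈ seg (f y) (f z)

/-- `f : T → T'` witnesses that `T` is a refinement of `T'`: it is an equivariant
continuous surjection preserving alignment. -/
def IsRefinementMap (G : Type*) {T T' : Type*} [Group G] [MetricSpace T] [MetricSpace T']
    [MulAction G T] [MulAction G T'] (f : T → T') : Prop :=
  Continuous f ∧ Surjective f ∧ AlignPreserving f ∧ ∀ (g : G) (x : T), f (g • x) = g • f x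

/-- The length functions of the two actions are homothetic. -/
def HomotheticLengths (G T₁ T₂ : Type*) [MetricSpace T₁] [MetricSpace T₂] [SMul G T₁]
    [SMul G T₂] : Prop :=
  ∃ c : ℝ, 0 < c ∧ ∀ g : G, translationLength T₁ g = c * translationLength T₂ g

/-- A bundled `ℝ`-tree with an isometric action of `G`. -/
structure GTree (G : Type*) [Group G] where
  carrier : Type
  [ms : MetricSpace carrier]
  [ma : MulAction G carrier]
  isom : ∀ (g : G) (x y : carrier), dist (g • x) (g • y) = dist x y
  tree : IsRTree carrier

attribute [instance] GTree.ms GTree.ma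

/-- A simplicial structure on an `ℝ`-tree: a vertex set containing all branch points,
meeting every segment in a finite set, and discrete. -/
def IsSimplicialStructure {T : Type*} [MetricSpace T] (V : Set T) : Prop :=
  (∀ x : T, IsBranchPoint x → x ∈ V) ∧
  (∀ x y : T, (seg x y ∩ V).Finite) ∧
  (∀ v ∈ V, ∃ ε > 0, ∀ w ∈ V, dist v w < ε → w = v)

/-- Two vertices of a simplicial tree are adjacent (span an edge). -/
def Adjacent {T : Type*} [MetricSpace T] (V : Set T) (v w : T) : Prop :=
  v ∈ V ∧ w ∈ V ∧ v ≠ w ∧ seg v w ∩ V = {v, w}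

/-- A bundled simplicial `G`-tree. -/
structure SimplicialGTree (G : Type*) [Group G] extends GTree G where
  V : Set carrier
  simp : IsSimplicialStructure V
  inv : ∀ g : G, (fun x => g • x) '' V = V

/-- `T₁` and `T₂` are refinements of a common non-trivial simplicial action of `G`. -/
def RefineCommonSimplicial (G T₁ T₂ : Type*) [Group G] [MetricSpace T₁] [MetricSpace T₂]
    [MulAction G T₁] [MulAction G T₂] : Prop :=
  ∃ T' : SimplicialGTree G, NontrivialAction G T'.carrier ∧
    (∃ f₁ : T₁ → T'.carrier, IsRefinementMap G f₁) ∧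
    (∃ f₂ : T₂ → T'.carrier, IsRefinementMap G f₂)

/-- Two directions face each other: their union is the whole tree. -/
def FacingDirections {T : Type*} [MetricSpace T] (δ δ' : Set T) : Prop :=
  δ ∪ δ' = univ

/-- There is a twice-light rectangle with (opposite) base corners `x` and `x'`:
two light quadrants based at `x` and `x'` facing each other. -/
def IsTwiceLightRect (G : Type*) {T₁ T₂ : Type*} [Group G] [MetricSpace T₁]
    [MetricSpace T₂] [MulAction G T₁] [MulAction G T₂] (x x' : T₁ × T₂) : Prop :=
  ∃ (δ₁ : Set T₁) (δ₂ : Set T₂) (δ₁' : Set T₁) (δ₂' : Set T₂),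
    IsDirectionAt δ₁ x.1 ∧ IsDirectionAt δ₂ x.2 ∧
    IsDirectionAt δ₁' x'.1 ∧ IsDirectionAt δ₂' x'.2 ∧
    x.1 ≠ x'.1 ∧ x.2 ≠ x'.2 ∧
    FacingDirections δ₁ δ₁' ∧ FacingDirections δ₂ δ₂' ∧
    ¬ Heavy G (δ₁ ×ˢ δ₂) ∧ ¬ Heavy G (δ₁' ×ˢ δ₂')

/-- The open rectangle with opposite corners `x, x'`. -/
def openRect {T₁ T₂ : Type*} [MetricSpace T₁] [MetricSpace T₂] (x x' : T₁ × T₂) :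
    Set (T₁ × T₂) :=
  openSeg x.1 x'.1 ×ˢ openSeg x.2 x'.2

/-- A maximal twice-light rectangle. -/
def IsMaxTwiceLightRect (G : Type*) {T₁ T₂ : Type*} [Group G] [MetricSpace T₁]
    [MetricSpace T₂] [MulAction G T₁] [MulAction G T₂] (x x' : T₁ × T₂) : Prop :=
  IsTwiceLightRect G x x' ∧ ∀ y y' : T₁ × T₂, IsTwiceLightRect G y y' →
    openRect x x' ⊆ openRect y y' → openRect x x' = openRect y y'

/-- The straight diagonal of a rectangle joining the two opposite corners `p` and `q`. -/
def mainDiag {T₁ T₂ : Type*} [MetricSpace T₁] [MetricSpace T₂] (p q : T₁ × T₂) :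
    Set (T₁ × T₂) :=
  {z : T₁ × T₂ | z.1 ∈ seg p.1 q.1 ∧ z.2 ∈ seg p.2 q.2 ∧
    dist p.1 z.1 * dist p.2 q.2 = dist p.2 z.2 * dist p.1 q.1}

/-- The augmented core: the union of the core and of the main diagonals of the maximal
twice-light rectangles (the diagonals joining the two opposite corners lying in the core). -/
def AugCore (G T₁ T₂ : Type*) [Group G] [MetricSpace T₁] [MetricSpace T₂]
    [MulAction G T₁] [MulAction G T₂] : Set (T₁ × T₂) :=
  Core G T₁ T₂ ∪
    {z : T₁ × T₂ | ∃ x x' p q : T₁ × T₂, IsMaxTwiceLightRect G x x' ∧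
      p ∈ Core G T₁ T₂ ∧ q ∈ Core G T₁ T₂ ∧
      ({p.1, q.1} : Set T₁) = {x.1, x'.1} ∧ ({p.2, q.2} : Set T₂) = {x.2, x'.2} ∧
      p.1 ≠ q.1 ∧ p.2 ≠ q.2 ∧ z ∈ mainDiag p q}

/-- There exists an equivariant (strong) deformation retraction of `T₁ × T₂` onto `C`. -/
def EquivDeformRetract (G : Type*) {T₁ T₂ : Type*} [Group G] [MetricSpace T₁]
    [MetricSpace T₂] [MulAction G T₁] [MulAction G T₂] (C : Set (T₁ × T₂)) : Prop :=
  ∃ H : ℝ → T₁ × T₂ → T₁ × T₂,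
    Continuous (fun p : ℝ × (T₁ × T₂) => H p.1 p.2) ∧
    (∀ z : T₁ × T₂, H 0 z = z) ∧
    (∀ z : T₁ × T₂, H 1 z ∈ C) ∧
    (∀ t : ℝ, ∀ z ∈ C, H t z = z) ∧
    (∀ (t : ℝ) (g : G) (z : T₁ × T₂), H t (g • z) = g • H t z)

/-- The `ℓ²` product distance on `T₁ × T₂`. -/
def dist2 {T₁ T₂ : Type*} [MetricSpace T₁] [MetricSpace T₂] (p q : T₁ × T₂) : ℝ :=
  Real.sqrt (dist p.1 q.1 ^ 2 + dist p.2 q.2 ^ 2)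

/-- The length of a path `c : [0,1] → T₁ × T₂`, measured with the `ℓ²` product metric. -/
def pathLen2 {T₁ T₂ : Type*} [MetricSpace T₁] [MetricSpace T₂] (c : ℝ → T₁ × T₂) :
    ℝ≥0∞ :=
  ⨆ (n : ℕ) (u : Fin (n + 1) → ℝ) (_ : Monotone u) (_ : ∀ i, u i ∈ Icc (0 : ℝ) 1),
    ∑ i : Fin n, ENNReal.ofReal (dist2 (c (u i.castSucc)) (c (u i.succ)))

/-- The path metric induced on a subset `C ⊆ T₁ × T₂` by the `ℓ²` product metric. -/
def pathDistOn {T₁ T₂ : Type*} [MetricSpace T₁] [MetricSpace T₂] (C : Set (T₁ × T₂))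
    (x y : C) : ℝ :=
  (⨅ (c : ℝ → T₁ × T₂) (_ : ContinuousOn c (Icc (0 : ℝ) 1))
      (_ : MapsTo c (Icc (0 : ℝ) 1) C) (_ : c 0 = (x : T₁ × T₂))
      (_ : c 1 = (y : T₁ × T₂)), pathLen2 c).toReal

/-- A distance function makes a set a CAT(0) space: it is a metric, geodesic, and the
CN-inequality of Bruhat–Tits holds (comparison triangles are at least as thick). -/
structure IsCAT0Dist {X : Type*} (d : X → X → ℝ) : Prop where
  refl : ∀ x, d x x = 0
  symm : ∀ x y, d x y = d y x
  triangle : ∀ x y z, d x z ≤ d x y + d y z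
  eq_of_dist_eq_zero : ∀ x y, d x y = 0 → x = y
  geodesic : ∀ x y, ∃ f : ℝ → X, f 0 = x ∧ f (d x y) = y ∧
    ∀ s ∈ Icc (0 : ℝ) (d x y), ∀ t ∈ Icc (0 : ℝ) (d x y), d (f s) (f t) = |s - t|
  cn : ∀ x y z m, d y m = d y z / 2 → d m z = d y z / 2 →
    d x m ^ 2 ≤ (d x y ^ 2 + d x z ^ 2) / 2 - d y z ^ 2 / 4

/-- A 2-cell of the core of a product of two simplicial trees: a rectangle which is a
product of two edges and is contained in the core. -/
def IsCoreCell (G : Type*) {T₁ T₂ : Type*} [Group G] [MetricSpace T₁] [MetricSpace T₂]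
    [MulAction G T₁] [MulAction G T₂] (V₁ : Set T₁) (V₂ : Set T₂)
    (R : Set (T₁ × T₂)) : Prop :=
  ∃ v₁ w₁ v₂ w₂, Adjacent V₁ v₁ w₁ ∧ Adjacent V₂ v₂ w₂ ∧
    R = seg v₁ w₁ ×ˢ seg v₂ w₂ ∧ R ⊆ Core G T₁ T₂

section Arcs

/-- `S` is the image of an injective path, parametrized by a real interval, from `x` to `y`. -/
def IsArc {T : Type*} [MetricSpace T] (S : Set T) (x y : T) : Prop :=
  ∃ (L : ℝ) (g : ℝ → T), 0 ≤ L ∧ ContinuousOn g (Icc 0 L) ∧ InjOn g (Icc 0 L) ∧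
    g 0 = x ∧ g L = y ∧ S = g '' Icc 0 L

variable {T : Type*} [MetricSpace T]

lemma IsArc.union {S S' : Set T} {x p z : T} (h : IsArc S x p) (h' : IsArc S' p z)
    (hS : ∀ v ∈ S, v ∈ S' → v = p) : IsArc (S ∪ S') x z := by
  obtain ⟨L, g, hL, hgc, hgi, hg0, hgL, rfl⟩ := h
  obtain ⟨L', g', hL', hgc', hgi', hg0', hgL', rfl⟩ := h'
  have hshift : MapsTo (fun s : ℝ => s - L) (Icc L (L + L')) (Icc 0 L') := fun s hs =>
    ⟨by linarith [hs.1], by linarith [hs.2]⟩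
  set k : ℝ → T := fun s => if s ≤ L then g s else g' (s - L) with hk
  have hk1 : EqOn k g (Icc 0 L) := fun s hs => by simp [hk, hs.2]
  have hk2 : EqOn k (fun s => g' (s - L)) (Icc L (L + L')) := by
    intro s hs
    rcases hs.1.eq_or_lt with h | h
    · simp [hk, ← h, hgL, hg0']
    · simp [hk, not_le.2 h]
  have hI : Icc (0 : ℝ) (L + L') = Icc 0 L ∪ Icc L (L + L') :=
    (Icc_union_Icc_eq_Icc hL (by linarith)).symm
  have himg : k '' Icc L (L + L') = g' '' Icc 0 L' := by
    rw [hk2.image_eq]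
    ext v
    constructor
    · rintro ⟨s, hs, rfl⟩
      exact ⟨s - L, hshift hs, rfl⟩
    · rintro ⟨s, hs, rfl⟩
      exact ⟨s + L, ⟨by linarith [hs.1], by linarith [hs.2]⟩, by simp⟩
  refine ⟨L + L', k, by linarith, ?_, ?_, ?_, ?_, ?_⟩
  · rw [hI]
    refine ContinuousOn.union_of_isClosed (hgc.congr hk1) ?_ isClosed_Icc isClosed_Icc
    exact (hgc'.comp (by fun_prop) hshift).congr hk2
  · have key : ∀ s ∈ Icc 0 L, ∀ t ∈ Icc L (L + L'), k s = k t → s = t := by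
      intro s hs t ht hst
      rw [hk1 hs, hk2 ht] at hst
      have h1 := hS (g s) (mem_image_of_mem g hs) (hst ▸ mem_image_of_mem g' (hshift ht))
      have h2 : s = L := hgi hs ⟨hL, le_rfl⟩ (by rw [h1, hgL])
      have h3 : t - L = 0 := hgi' (hshift ht) ⟨le_rfl, hL'⟩ (by
        rw [hg0', ← h1]; exact hst.symm)
      linarith
    rw [hI]
    rintro s (hs | hs) t (ht | ht) hst
    · exact hgi hs ht (by rwa [hk1 hs, hk1 ht] at hst)
    · exact key s hs t ht hst
    · exact (key t ht s hs hst.symm).symm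
    · rw [hk2 hs, hk2 ht] at hst
      have := hgi' (hshift hs) (hshift ht) hst
      simpa using this
  · rw [hk1 ⟨le_rfl, hL⟩, hg0]
  · rw [hk2 ⟨by linarith, le_rfl⟩]
    simpa using hgL'
  · rw [hI, image_union, hk1.image_eq, himg]

lemma IsArc.exists_path {S : Set T} {x y : T} (h : IsArc S x y) (hxy : x ≠ y) :
    ∃ γ : Path x y, Injective γ ∧ range γ = S := by
  obtain ⟨L, g, hL, hgc, hgi, hg0, hgL, rfl⟩ := h
  have hL0 : 0 < L := hL.lt_of_ne (by rintro rfl; exact hxy (hg0.symm.trans hgL))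
  have hm : ∀ t : unitInterval, (t : ℝ) * L ∈ Icc 0 L := fun t =>
    ⟨mul_nonneg t.2.1 hL, by nlinarith [t.2.2]⟩
  refine ⟨⟨⟨fun t => g (t * L), ?_⟩, by simp [hg0], by simp [hgL]⟩, ?_, ?_⟩
  · exact hgc.comp_continuous (by fun_prop) hm
  · intro s t hst
    have := hgi (hm s) (hm t) hst
    exact Subtype.ext (mul_right_cancel₀ hL0.ne' this)
  · ext v
    constructor
    · rintro ⟨t, rfl⟩
      exact ⟨_, hm t, rfl⟩
    · rintro ⟨s, hs, rfl⟩
      refine ⟨⟨s / L, by have := hs.1; positivity, (div_le_one hL0).2 hs.2⟩, ?_⟩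
      show g (s / L * L) = g s
      rw [div_mul_cancel₀ _ hL0.ne']

lemma IsRTree.arc_eq (hT : IsRTree T) {S S' : Set T} {x y : T} (h : IsArc S x y)
    (h' : IsArc S' x y) (hxy : x ≠ y) : S = S' := by
  obtain ⟨γ, hγ, rfl⟩ := h.exists_path hxy
  obtain ⟨γ', hγ', rfl⟩ := h'.exists_path hxy
  exact hT.arc_unique x y γ γ' hγ hγ'

lemma continuousOn_of_dist_eq {f : ℝ → T} {I : Set ℝ}
    (hf : ∀ s ∈ I, ∀ t ∈ I, dist (f s) (f t) = |s - t|) : ContinuousOn f I := by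
  rw [Metric.continuousOn_iff]
  intro b hb ε hε
  exact ⟨ε, hε, fun a ha hab => by rw [hf a ha b hb]; rwa [Real.dist_eq] at hab⟩

lemma injOn_of_dist_eq {f : ℝ → T} {I : Set ℝ}
    (hf : ∀ s ∈ I, ∀ t ∈ I, dist (f s) (f t) = |s - t|) : InjOn f I := by
  intro s hs t ht hst
  have := hf s hs t ht
  rw [hst, dist_self] at this
  linarith [abs_eq_zero.1 this.symm]

lemma isArc_of_dist_eq {f : ℝ → T} {a b : ℝ} (hab : a ≤ b)
    (hf : ∀ s ∈ Icc a b, ∀ t ∈ Icc a b, dist (f s) (f t) = |s - t|) :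
    IsArc (f '' Icc a b) (f a) (f b) := by
  have hm : MapsTo (fun s : ℝ => s + a) (Icc 0 (b - a)) (Icc a b) := fun s hs =>
    ⟨by linarith [hs.1], by linarith [hs.2]⟩
  refine ⟨b - a, fun s => f (s + a), by linarith, ?_, ?_, by simp, by simp, ?_⟩
  · exact (continuousOn_of_dist_eq hf).comp (by fun_prop) hm
  · intro s hs t ht hst
    have := injOn_of_dist_eq hf (hm hs) (hm ht) hst
    simpa using this
  · ext v
    constructor
    · rintro ⟨s, hs, rfl⟩
      exact ⟨s - a, ⟨by linarith [hs.1], by linarith [hs.2]⟩, by simp⟩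
    · rintro ⟨s, hs, rfl⟩
      exact ⟨s + a, hm hs, rfl⟩

end Arcs

section Trees

variable {T : Type*} [MetricSpace T]

lemma mem_seg {x y p : T} : p ∈ seg x y ↔ dist x p + dist p y = dist x y := Iff.rfl

lemma seg_symm (x y : T) : seg x y = seg y x := by
  ext p
  rw [mem_seg, mem_seg, dist_comm y p, dist_comm p x, dist_comm y x, add_comm]

lemma left_mem_seg (x y : T) : x ∈ seg x y := by simp [mem_seg]

lemma right_mem_seg (x y : T) : y ∈ seg x y := by simp [mem_seg]

lemma isClosed_seg (x y : T) : IsClosed (seg x y) :=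
  isClosed_eq (by fun_prop) (by fun_prop)

/-- A geodesic is contained in the segment between its endpoints. -/
lemma mem_seg_of_dist_eq {f : ℝ → T} {L : ℝ}
    (hf : ∀ s ∈ Icc 0 L, ∀ t ∈ Icc 0 L, dist (f s) (f t) = |s - t|) {a b c : ℝ}
    (ha : 0 ≤ a) (hab : a ≤ b) (hbc : b ≤ c) (hc : c ≤ L) : f b ∈ seg (f a) (f c) := by
  rw [mem_seg, hf a ⟨ha, by linarith⟩ b ⟨by linarith, by linarith⟩,
    hf b ⟨by linarith, by linarith⟩ c ⟨by linarith, hc⟩,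
    hf a ⟨ha, by linarith⟩ c ⟨by linarith, hc⟩, abs_of_nonpos (by linarith),
    abs_of_nonpos (by linarith), abs_of_nonpos (by linarith)]
  ring

/-- A point on one side of a geodesic triangle lies on one of the two other sides. -/
lemma IsRTree.mem_seg_or (hT : IsRTree T) {w y z : T} (hw : w ∈ seg y z) (x : T) :
    w ∈ seg y x ∨ w ∈ seg x z := by
  by_cases hyz : y = z
  · subst hyz
    left
    rw [mem_seg, dist_self, dist_comm w y] at hw
    have : y = w := dist_eq_zero.1 (by linarith [dist_nonneg (x := y) (y := w)])
    rw [← this]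
    exact left_mem_seg _ _
  obtain ⟨f₁, hf₁0, hf₁L, hf₁⟩ := hT.exists_geod y w
  obtain ⟨f₂, hf₂0, hf₂L, hf₂⟩ := hT.exists_geod w z
  obtain ⟨f, hf0, hfL, hf⟩ := hT.exists_geod y x
  obtain ⟨h, hh0, hhL, hh⟩ := hT.exists_geod x z
  have hA : IsArc (f₁ '' Icc 0 (dist y w) ∪ f₂ '' Icc 0 (dist w z)) y z := by
    have h₁ := isArc_of_dist_eq dist_nonneg hf₁
    have h₂ := isArc_of_dist_eq dist_nonneg hf₂
    rw [hf₁0, hf₁L] at h₁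
    rw [hf₂0, hf₂L] at h₂
    refine h₁.union h₂ ?_
    rintro v ⟨s, hs, rfl⟩ ⟨t, ht, hv⟩
    have e₁ := mem_seg_of_dist_eq hf₁ le_rfl hs.1 hs.2 le_rfl
    have e₂ := mem_seg_of_dist_eq hf₂ le_rfl ht.1 ht.2 le_rfl
    rw [hf₁0, hf₁L, mem_seg] at e₁
    rw [hf₂0, hf₂L, hv, mem_seg, dist_comm w] at e₂
    rw [mem_seg] at hw
    have := dist_triangle y (f₁ s) z
    exact dist_eq_zero.1 (by linarith [dist_nonneg (x := f₁ s) (y := w)])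
  have hcf := continuousOn_of_dist_eq hf
  have hK : IsClosed (h '' Icc 0 (dist x z)) :=
    (isCompact_Icc.image_of_continuousOn (continuousOn_of_dist_eq hh)).isClosed
  have hZ : IsCompact (Icc 0 (dist y x) ∩ f ⁻¹' (h '' Icc 0 (dist x z))) :=
    isCompact_Icc.of_isClosed_subset (hcf.preimage_isClosed_of_isClosed isClosed_Icc hK)
      inter_subset_left
  have hne : (Icc 0 (dist y x) ∩ f ⁻¹' (h '' Icc 0 (dist x z))).Nonempty :=
    ⟨dist y x, ⟨dist_nonneg, le_rfl⟩, 0, ⟨le_rfl, dist_nonneg⟩, by rw [hfL, hh0]⟩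
  obtain ⟨s₀, ⟨hs₀, u₀, hu₀, hsu⟩, hmin⟩ := hZ.exists_isLeast hne
  have hB : IsArc (f '' Icc 0 s₀ ∪ h '' Icc u₀ (dist x z)) y z := by
    have h₁ := isArc_of_dist_eq hs₀.1 (fun s hs t ht =>
      hf s ⟨hs.1, hs.2.trans hs₀.2⟩ t ⟨ht.1, ht.2.trans hs₀.2⟩)
    have h₂ := isArc_of_dist_eq hu₀.2 (fun s hs t ht =>
      hh s ⟨hu₀.1.trans hs.1, hs.2⟩ t ⟨hu₀.1.trans ht.1, ht.2⟩)
    rw [hf0] at h₁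
    rw [hhL, hsu] at h₂
    refine h₁.union h₂ ?_
    rintro v ⟨s, hs, rfl⟩ ⟨t, ht, hv⟩
    have := hmin ⟨⟨hs.1, hs.2.trans hs₀.2⟩, t, ⟨hu₀.1.trans ht.1, ht.2⟩, hv⟩
    rw [le_antisymm hs.2 this]
  have hwA : w ∈ f₁ '' Icc 0 (dist y w) ∪ f₂ '' Icc 0 (dist w z) :=
    Or.inl ⟨dist y w, ⟨dist_nonneg, le_rfl⟩, hf₁L⟩
  rw [hT.arc_eq hA hB hyz] at hwA
  rcases hwA with ⟨s, hs, rfl⟩ | ⟨s, hs, rfl⟩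
  · left
    have := mem_seg_of_dist_eq hf le_rfl hs.1 (hs.2.trans hs₀.2) le_rfl
    rwa [hf0, hfL] at this
  · right
    have := mem_seg_of_dist_eq hh le_rfl (hu₀.1.trans hs.1) hs.2 le_rfl
    rwa [hh0, hhL] at this

lemma IsRTree.exists_mem_seg (hT : IsRTree T) (x y : T) {r : ℝ} (hr0 : 0 ≤ r)
    (hr : r ≤ dist x y) : ∃ s ∈ seg x y, dist x s = r ∧ dist s y = dist x y - r := by
  obtain ⟨f, hf0, hfL, hf⟩ := hT.exists_geod x y
  have h1 := mem_seg_of_dist_eq hf le_rfl hr0 hr le_rfl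
  rw [hf0, hfL] at h1
  have h2 := hf 0 ⟨le_rfl, dist_nonneg⟩ r ⟨hr0, hr⟩
  rw [hf0, zero_sub, abs_neg, abs_of_nonneg hr0] at h2
  exact ⟨f r, h1, h2, by rw [mem_seg] at h1; linarith⟩

lemma IsRTree.eq_of_mem_seg (hT : IsRTree T) {x y p q : T} (hp : p ∈ seg x y)
    (hq : q ∈ seg x y) (h : dist x p = dist x q) : p = q := by
  have hp' := hp
  have hq' := hq
  rw [mem_seg] at hp hq
  apply dist_eq_zero.1
  rcases hT.mem_seg_or hp' q with h1 | h1 <;> rw [mem_seg] at h1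
  · linarith
  · rw [dist_comm]
    linarith

lemma IsRTree.isCompact_seg (hT : IsRTree T) (x y : T) : IsCompact (seg x y) := by
  obtain ⟨f, hf0, hfL, hf⟩ := hT.exists_geod x y
  have h := isCompact_Icc.image_of_continuousOn (continuousOn_of_dist_eq hf)
  refine h.of_isClosed_subset (isClosed_seg x y) fun p hp => ?_
  have hr : dist x p ≤ dist x y := by
    rw [mem_seg] at hp; linarith [dist_nonneg (x := p) (y := y)]
  have h1 := mem_seg_of_dist_eq hf le_rfl dist_nonneg hr le_rfl
  have h2 := hf 0 ⟨le_rfl, dist_nonneg⟩ (dist x p) ⟨dist_nonneg, hr⟩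
  rw [hf0, hfL] at h1
  rw [hf0, zero_sub, abs_neg, abs_of_nonneg dist_nonneg] at h2
  exact ⟨dist x p, ⟨dist_nonneg, hr⟩, hT.eq_of_mem_seg h1 hp h2⟩

/-- The points that `w` does not separate from `y`. -/
def dirAt (w y : T) : Set T := {x | w ∉ seg x y}

lemma mem_dirAt {w x y : T} : x ∈ dirAt w y ↔ w ∉ seg x y := Iff.rfl

lemma mem_dirAt_comm {w x y : T} : x ∈ dirAt w y ↔ y ∈ dirAt w x := by
  rw [mem_dirAt, mem_dirAt, seg_symm]

lemma not_mem_dirAt_self (w y : T) : w ∉ dirAt w y := fun h => h (left_mem_seg _ _)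

lemma self_mem_dirAt {w y : T} (h : y ≠ w) : y ∈ dirAt w y := by
  rw [mem_dirAt, mem_seg, dist_self, dist_comm y w]
  intro h'
  exact h (dist_eq_zero.1 (by rw [dist_comm]; linarith [dist_nonneg (x := w) (y := y)]))

lemma IsRTree.mem_dirAt_trans (hT : IsRTree T) {w x y z : T} (h : x ∈ dirAt w y)
    (h' : y ∈ dirAt w z) : x ∈ dirAt w z :=
  fun hw => (hT.mem_seg_or hw y).elim h h'

lemma IsRTree.dirAt_eq (hT : IsRTree T) {w x y : T} (h : x ∈ dirAt w y) :
    dirAt w x = dirAt w y :=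
  Subset.antisymm (fun _ hv => hT.mem_dirAt_trans hv h)
    (fun _ hv => hT.mem_dirAt_trans hv (mem_dirAt_comm.1 h))

lemma IsRTree.mem_seg_of_mem_dirAt (hT : IsRTree T) {w y s u : T} (hs : s ∈ dirAt w y)
    (hu : u ∉ dirAt w y) : w ∈ seg s u := by
  by_contra h
  exact hu (hT.mem_dirAt_trans (mem_dirAt_comm.1 h) hs)

lemma eq_of_mem_seg_of_mem_seg {x y p : T} (h : x ∈ seg p y) (h' : y ∈ seg p x) : x = y := by
  rw [mem_seg] at h h'
  rw [dist_comm y x] at h'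
  exact dist_eq_zero.1 (by linarith [dist_nonneg (x := x) (y := y)])

lemma IsRTree.preconnected_seg_image {f : ℝ → T} {L : ℝ}
    (hf : ∀ s ∈ Icc 0 L, ∀ t ∈ Icc 0 L, dist (f s) (f t) = |s - t|) :
    IsPreconnected (f '' Icc 0 L) :=
  isPreconnected_Icc.image _ (continuousOn_of_dist_eq hf)

lemma IsRTree.connectedComponentIn_eq (hT : IsRTree T) {w y : T} (h : y ≠ w) :
    connectedComponentIn {w}ᶜ y = dirAt w y := by
  apply Subset.antisymm
  · have hpc : IsPreconnected (connectedComponentIn {w}ᶜ y) := isPreconnected_connectedComponentIn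
    have hsub : connectedComponentIn {w}ᶜ y ⊆ {w}ᶜ := connectedComponentIn_subset _ _
    have hy : y ∈ connectedComponentIn {w}ᶜ y := mem_connectedComponentIn h
    have hnear : ∀ a b : T, dist a b < dist a w → a ∈ dirAt w b := by
      intro a b hab hw
      rw [mem_seg] at hw
      linarith [dist_nonneg (x := w) (y := b)]
    have hopen : ∀ z, IsOpen (dirAt w z) := by
      intro z
      rw [Metric.isOpen_iff]
      intro a ha
      have haw : 0 < dist a w := dist_pos.2 (by rintro rfl; exact not_mem_dirAt_self _ _ ha)
      refine ⟨dist a w, haw, fun b hb => ?_⟩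
      rw [mem_ball, dist_comm] at hb
      exact hT.mem_dirAt_trans (mem_dirAt_comm.1 (hnear a b hb)) ha
    intro x hx
    by_contra hxn
    have := hpc (dirAt w y) (⋃ z ∈ {z | z ∉ dirAt w y}, dirAt w z) (hopen y)
      (isOpen_biUnion fun z _ => hopen z) ?_ ⟨y, hy, self_mem_dirAt h⟩
      ⟨x, hx, mem_biUnion hxn (self_mem_dirAt (hsub hx))⟩
    · obtain ⟨v, -, hv, hv'⟩ := this
      obtain ⟨z, hz, hvz⟩ := mem_iUnion₂.1 hv'
      exact hz (hT.mem_dirAt_trans (mem_dirAt_comm.1 hvz) hv)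
    · intro v hv
      by_cases hvy : v ∈ dirAt w y
      · exact Or.inl hvy
      · exact Or.inr (mem_biUnion hvy (self_mem_dirAt (hsub hv)))
  · intro x hx
    obtain ⟨f, hf0, hfL, hf⟩ := hT.exists_geod x y
    have hc := IsRTree.preconnected_seg_image hf
    refine hc.subset_connectedComponentIn ⟨dist x y, ⟨dist_nonneg, le_rfl⟩, hfL⟩ ?_
      ⟨0, ⟨le_rfl, dist_nonneg⟩, hf0⟩
    rintro _ ⟨s, hs, rfl⟩ hsw
    rw [mem_singleton_iff] at hsw
    apply hx
    have := mem_seg_of_dist_eq hf le_rfl hs.1 hs.2 le_rfl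
    rwa [hf0, hfL, hsw] at this

lemma IsRTree.isDirectionAt_iff (hT : IsRTree T) {δ : Set T} {w : T} :
    IsDirectionAt δ w ↔ ∃ y, y ≠ w ∧ δ = dirAt w y :=
  exists_congr fun _ => and_congr_right fun h => by rw [hT.connectedComponentIn_eq h]

/-- Relative position of two directions, the second one containing the base point of the
first one. -/
lemma IsRTree.compl_dirAt_subset (hT : IsRTree T) {a y a' y' : T} (ha : a ∈ dirAt a' y')
    (ha' : a' ∈ dirAt a y) : (dirAt a y)ᶜ ⊆ dirAt a' y' := by
  intro u hu
  refine hT.mem_dirAt_trans (y := a) (fun h => ?_) ha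
  have h1 : a ∈ seg u a' := by rw [seg_symm]; exact hT.mem_seg_of_mem_dirAt ha' hu
  rw [eq_of_mem_seg_of_mem_seg h h1] at ha'
  exact not_mem_dirAt_self _ _ ha'

lemma IsRTree.dirAt_subset (hT : IsRTree T) {a y a' y' : T} (ha : a ∈ dirAt a' y')
    (ha' : a' ∉ dirAt a y) : dirAt a y ⊆ dirAt a' y' := by
  intro v hv
  refine hT.mem_dirAt_trans (y := a) (fun h => ?_) ha
  rw [eq_of_mem_seg_of_mem_seg h (hT.mem_seg_of_mem_dirAt hv ha')] at ha
  exact not_mem_dirAt_self _ _ ha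

lemma IsRTree.treeConvex_compl_dirAt (hT : IsRTree T) (a y : T) :
    TreeConvex (dirAt a y)ᶜ := by
  intro u hu v hv p hp hpa
  have h1 := hT.mem_seg_of_mem_dirAt hpa hu
  have h2 := hT.mem_seg_of_mem_dirAt hpa hv
  have : p = a := by
    rw [mem_seg] at h1 h2 hp
    rw [dist_comm u p] at hp
    have := dist_triangle u a v
    rw [dist_comm u a] at this
    exact dist_eq_zero.1 (by linarith [dist_nonneg (x := p) (y := a)])
  rw [this] at hpa
  exact not_mem_dirAt_self _ _ hpa

lemma isClosed_compl_dirAt (a y : T) : IsClosed (dirAt a y)ᶜ := by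
  have : (dirAt a y)ᶜ = {x | dist x a + dist a y = dist x y} := by
    ext x
    simp [dirAt, mem_seg]
  rw [this]
  exact isClosed_eq (by fun_prop) (by fun_prop)

/-- The Gromov product: the distance from `c'` to the projection of `e` on `[c', c]`. -/
def gprod (c' c e : T) : ℝ := (dist c' e + dist c' c - dist e c) / 2

lemma gprod_nonneg (c' c e : T) : 0 ≤ gprod c' c e := by
  have := dist_triangle e c' c
  rw [dist_comm e c'] at this
  unfold gprod
  linarith

lemma gprod_le (c' c e : T) : gprod c' c e ≤ dist c' c := by
  have := dist_triangle c' c e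
  rw [dist_comm c e] at this
  unfold gprod
  linarith

lemma gprod_of_mem_seg {c' c s : T} (hs : s ∈ seg c' c) : gprod c' c s = dist c' s := by
  rw [mem_seg] at hs
  unfold gprod
  linarith

lemma gprod_swap (c' c e : T) : gprod c c' e = dist c' c - gprod c' c e := by
  unfold gprod
  rw [dist_comm c c', dist_comm c e, dist_comm e c']
  ring

lemma IsRTree.mem_dirAt_iff_lt_gprod (hT : IsRTree T) {c' c s e : T} (hs : s ∈ seg c' c) :
    e ∈ dirAt s c ↔ dist c' s < gprod c' c e := by
  have hs' := hs
  rw [mem_seg] at hs'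
  constructor
  · intro h
    have h1 := (hT.mem_seg_or hs e).resolve_right h
    have h2 : dist e c < dist e s + dist s c := lt_of_le_of_ne (dist_triangle _ _ _) (Ne.symm h)
    rw [mem_seg] at h1
    rw [dist_comm e s] at h2
    unfold gprod
    linarith
  · intro h h1
    rw [mem_seg] at h1
    have := dist_triangle c' s e
    rw [dist_comm s e] at this
    unfold gprod at h
    linarith

lemma IsRTree.mem_dirAt_iff_gprod_lt (hT : IsRTree T) {c' c s e : T} (hs : s ∈ seg c' c) :
    e ∈ dirAt s c' ↔ gprod c' c e < dist c' s := by
  have hs' := hs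
  rw [seg_symm] at hs
  rw [hT.mem_dirAt_iff_lt_gprod hs, gprod_swap c' c]
  rw [mem_seg] at hs'
  rw [dist_comm c s]
  constructor <;> intro h <;> linarith

/-- The trace on a segment of a direction meeting that segment. -/
lemma IsRTree.dirAt_trichotomy (hT : IsRTree T) {c' c z a y : T} (hz : z ∈ seg c' c)
    (h : z ∈ dirAt a y) :
    (c' ∈ dirAt a y ∧ c ∈ dirAt a y) ∨
    (c' ∈ dirAt a y ∧ c ∉ dirAt a y ∧ ∃ r, dist c' z < r ∧ dirAt a y = {e | gprod c' c e < r}) ∨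
    (c ∈ dirAt a y ∧ c' ∉ dirAt a y ∧ ∃ r, r < dist c' z ∧ dirAt a y = {e | r < gprod c' c e}) := by
  have hz' := hz
  rw [mem_seg] at hz'
  by_cases hc' : c' ∈ dirAt a y <;> by_cases hc : c ∈ dirAt a y
  · exact Or.inl ⟨hc', hc⟩
  · refine Or.inr (Or.inl ⟨hc', hc, dist c' a, ?_, ?_⟩)
    · have ha := hT.mem_seg_of_mem_dirAt hc' hc
      rw [← gprod_of_mem_seg hz, ← hT.mem_dirAt_iff_gprod_lt ha, hT.dirAt_eq hc']
      exact h
    · have ha := hT.mem_seg_of_mem_dirAt hc' hc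
      ext e
      rw [mem_ofPred_eq, ← hT.mem_dirAt_iff_gprod_lt ha, hT.dirAt_eq hc']
  · have ha := hT.mem_seg_of_mem_dirAt hc hc'
    rw [seg_symm] at ha
    refine Or.inr (Or.inr ⟨hc, hc', dist c' a, ?_, ?_⟩)
    · rw [← gprod_of_mem_seg hz, ← hT.mem_dirAt_iff_lt_gprod ha, hT.dirAt_eq hc]
      exact h
    · ext e
      rw [mem_ofPred_eq, ← hT.mem_dirAt_iff_lt_gprod ha, hT.dirAt_eq hc]
  · exact absurd h (hT.treeConvex_compl_dirAt a y c' hc' c hc hz)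

/-- A point off a segment is separated from it by a direction. -/
lemma IsRTree.exists_dirAt_of_not_mem_seg (hT : IsRTree T) {y z w : T} (hw : w ∉ seg y z) :
    ∃ r, w ≠ r ∧ y ∉ dirAt r w ∧ z ∉ dirAt r w := by
  obtain ⟨r, hr, hr1, hr2⟩ := hT.exists_mem_seg y z (gprod_nonneg y z w) (gprod_le y z w)
  refine ⟨r, by rintro rfl; exact hw hr, ?_, ?_⟩
  · rw [mem_dirAt_comm, hT.mem_dirAt_iff_gprod_lt hr, hr1]
    exact lt_irrefl _
  · rw [mem_dirAt_comm, hT.mem_dirAt_iff_lt_gprod hr, hr1]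
    exact lt_irrefl _

end Trees

/-! ### Gluing of spaces of non-positive curvature -/

section Gluing

variable {α : Type*} [MetricSpace α]

/-- The CN inequality, seen from `x`, for `w` as the point at fraction `t` between `y` and `z`. -/
def CNAt (t : ℝ) (y z w x : α) : Prop :=
  dist x w ^ 2 ≤ (1 - t) * dist x y ^ 2 + t * dist x z ^ 2 - t * (1 - t) * dist y z ^ 2

lemma CNAt.swap {t : ℝ} {y z w x : α} (h : CNAt t y z w x) : CNAt (1 - t) z y w x := by
  unfold CNAt at *
  rw [dist_comm z y]
  linarith

lemma CNAt.dist_left_le {t : ℝ} (ht : t ∈ Icc (0 : ℝ) 1) {y z w : α} (h : CNAt t y z w y) :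
    dist y w ≤ t * dist y z := by
  unfold CNAt at h
  rw [dist_self] at h
  exact abs_le_of_sq_le_sq' (by linarith) (mul_nonneg ht.1 dist_nonneg) |>.2

lemma CNAt.dist_right_le {t : ℝ} (ht : t ∈ Icc (0 : ℝ) 1) {y z w : α} (h : CNAt t y z w z) :
    dist w z ≤ (1 - t) * dist y z := by
  have := h.swap.dist_left_le ⟨by linarith [ht.2], by linarith [ht.1]⟩
  rwa [dist_comm w, dist_comm y]

lemma CNAt.eq_of_dist_le {t : ℝ} (ht : t ∈ Icc (0 : ℝ) 1) {y z w w' : α} (h : CNAt t y z w w')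
    (h0 : dist y w' ≤ t * dist y z) (h1 : dist w' z ≤ (1 - t) * dist y z) : w' = w := by
  unfold CNAt at h
  have e0 := pow_le_pow_left₀ dist_nonneg h0 2
  have e1 := pow_le_pow_left₀ dist_nonneg h1 2
  rw [dist_comm y w'] at e0
  have e0' := mul_le_mul_of_nonneg_left e0 (sub_nonneg.2 ht.2)
  have e1' := mul_le_mul_of_nonneg_left e1 ht.1
  have : dist w' w ^ 2 ≤ 0 := by linarith
  exact dist_eq_zero.1 (pow_eq_zero_iff two_ne_zero |>.1 (le_antisymm this (sq_nonneg _)))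

/-- Convexity of the square, for the two pieces of a broken path. -/
lemma mul_sq_le_of_le_add {σ a b c : ℝ} (hσ : σ ∈ Icc (0 : ℝ) 1) (hc : 0 ≤ c) (h : c ≤ a + b) :
    σ * (1 - σ) * c ^ 2 ≤ (1 - σ) * a ^ 2 + σ * b ^ 2 := by
  have h1 : c ^ 2 ≤ (a + b) ^ 2 := pow_le_pow_left₀ hc h 2
  have h2 := mul_le_mul_of_nonneg_left h1 (mul_nonneg hσ.1 (sub_nonneg.2 hσ.2))
  nlinarith [sq_nonneg ((1 - σ) * a - σ * b)]

/-- The CN inequality at a point `m` of `[γ₀, γ₁]` seen from `x`, obtained by subdividing the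
triangle `x γ₀ γ₁` with a point `b` of `[x, γ₁]`. -/
lemma CNAt.of_subdivision {x γ₀ γ₁ m b : α} {t l : ℝ} (ht : t ∈ Icc (0 : ℝ) 1)
    (hl : l ∈ Icc (0 : ℝ) 1) (hxb : dist x b = l * dist x γ₁)
    (hbγ : dist b γ₁ = (1 - l) * dist x γ₁)
    (hn : ∀ ρ ∈ Icc (0 : ℝ) 1, ∃ n, CNAt ρ γ₀ b n x ∧ CNAt ρ γ₀ b n m)
    (hb : CNAt t γ₀ γ₁ m b) (hm : dist γ₀ m ≤ t * dist γ₀ γ₁) : CNAt t γ₀ γ₁ m x := by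
  rcases hl.1.eq_or_lt with rfl | hl0
  · rw [zero_mul, dist_eq_zero] at hxb
    rwa [hxb]
  rcases ht.1.eq_or_lt with rfl | ht0
  · rw [zero_mul] at hm
    have : γ₀ = m := dist_eq_zero.1 (le_antisymm hm dist_nonneg)
    subst this
    simp [CNAt]
  rcases hl.2.eq_or_lt with rfl | hl1
  · rw [sub_self, zero_mul, dist_eq_zero] at hbγ
    subst hbγ
    obtain ⟨n, hn1, hn2⟩ := hn t ht
    rwa [hn2.eq_of_dist_le ht hm (hb.dist_right_le ht)]
  have hden : 0 < t + l * (1 - t) := by nlinarith [ht.2]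
  obtain ⟨ρ, hρ⟩ : ∃ ρ, ρ = t / (t + l * (1 - t)) := ⟨_, rfl⟩
  obtain ⟨σ, hσ⟩ : ∃ σ, σ = l / (t + l * (1 - t)) := ⟨_, rfl⟩
  have hρ0 : 0 < ρ := hρ ▸ div_pos ht0 hden
  have hσ0 : 0 < σ := hσ ▸ div_pos hl0 hden
  have e1 : 1 - ρ = σ * (1 - t) := by rw [hρ, hσ]; field_simp; ring
  have e2 : 1 - σ = ρ * (1 - l) := by rw [hρ, hσ]; field_simp; ring
  have e3 : ρ * l = σ * t := by rw [hρ, hσ]; field_simp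
  have hσ1 : 0 < 1 - σ := e2 ▸ mul_pos hρ0 (by linarith)
  have hρ1 : 0 ≤ 1 - ρ := e1 ▸ mul_nonneg hσ0.le (by linarith [ht.2])
  obtain ⟨n, hnx, hnm⟩ := hn ρ ⟨hρ0.le, by linarith⟩
  have key := mul_sq_le_of_le_add ⟨hσ0.le, by linarith⟩ dist_nonneg (dist_triangle x n m)
  have hm2 := pow_le_pow_left₀ dist_nonneg hm 2
  unfold CNAt at *
  rw [dist_comm γ₀ m] at hm2
  rw [dist_comm n m] at key
  rw [dist_comm b m, dist_comm b γ₀, hbγ] at hb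
  rw [hxb] at hnx
  have k1 := mul_le_mul_of_nonneg_left hnx hσ1.le
  have k2 := mul_le_mul_of_nonneg_left hnm hσ0.le
  have k3 := mul_le_mul_of_nonneg_left hm2 (mul_nonneg hσ0.le hρ1)
  have k4 := mul_le_mul_of_nonneg_left hb (mul_nonneg hσ0.le hρ0.le)
  refine le_of_mul_le_mul_left ?_ (mul_pos hσ0 hσ1)
  generalize dist x m ^ 2 = A at *
  generalize dist x n ^ 2 = B at *
  generalize dist m n ^ 2 = C at *
  generalize dist m b ^ 2 = F at *
  generalize dist m γ₀ ^ 2 = H at *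
  generalize dist x γ₀ ^ 2 = I at *
  generalize dist γ₀ b ^ 2 = J at *
  generalize dist γ₀ γ₁ = D at *
  generalize dist x γ₁ = P at *
  have k := add_le_add (add_le_add key k1) (add_le_add (add_le_add k2 k3) k4)
  have cJ : -(ρ * (1 - ρ)) * J + σ * ρ * (1 - t) * J = 0 := by rw [e1]; ring
  have cI : (1 - σ) * (1 - ρ) * I = σ * (1 - σ) * (1 - t) * I := by rw [e1]; ring
  have cP : (1 - σ) * ρ * (l * P) ^ 2 + σ * ρ * t * ((1 - l) * P) ^ 2
      = σ * (1 - σ) * t * P ^ 2 := by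
    have : (1 - σ) * ρ * (l * P) ^ 2 + σ * ρ * t * ((1 - l) * P) ^ 2
      = (1 - σ) * l * (ρ * l) * P ^ 2 + σ * t * (1 - l) * (ρ * (1 - l)) * P ^ 2 := by ring
    rw [this, e3, ← e2]; ring
  have cD : σ * (1 - ρ) * (t * D) ^ 2 - σ * ρ * (t * (1 - t) * D ^ 2)
      = -(σ * (1 - σ)) * (t * (1 - t) * D ^ 2) := by
    have : ρ = 1 - σ * (1 - t) := by linarith
    rw [this]; ring
  linarith

/-- Every pair of points of `X` has, for each `t ∈ [0,1]`, a point of `X` at fraction `t` between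
them satisfying the CN inequality with respect to all points of `Y`. -/
def CNSet (X Y : Set α) : Prop :=
  ∀ y ∈ X, ∀ z ∈ X, ∀ t ∈ Icc (0 : ℝ) 1, ∃ w ∈ X, ∀ x ∈ Y, CNAt t y z w x

/-- The assumptions of the gluing lemma. -/
structure GluingData (X₁ X₂ : Set α) : Prop where
  cover : ∀ x, x ∈ X₁ ∨ x ∈ X₂
  left : CNSet X₁ X₁
  right : CNSet X₂ X₂
  inter : CNSet (X₁ ∩ X₂) univ
  mixed : ∀ x ∈ X₁, ∀ y ∈ X₂, ∃ c ∈ X₁ ∩ X₂, dist x y = dist x c + dist c y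

lemma GluingData.swap {X₁ X₂ : Set α} (h : GluingData X₁ X₂) : GluingData X₂ X₁ where
  cover x := (h.cover x).symm
  left := h.right
  right := h.left
  inter := by rw [inter_comm]; exact h.inter
  mixed x hx y hy := by
    obtain ⟨c, hc, e⟩ := h.mixed y hy x hx
    exact ⟨c, hc.symm, by rw [dist_comm x y, e, dist_comm x c, dist_comm c y, add_comm]⟩

lemma exists_fraction {x c y : α} (h : dist x y = dist x c + dist c y) :
    ∃ l ∈ Icc (0 : ℝ) 1, dist x c = l * dist x y ∧ dist c y = (1 - l) * dist x y := by
  have h1 := dist_nonneg (x := x) (y := c)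
  have h2 := dist_nonneg (x := c) (y := y)
  rcases (dist_nonneg (x := x) (y := y)).eq_or_lt with h0 | h0
  · exact ⟨0, by simp, by linarith, by linarith⟩
  · refine ⟨dist x c / dist x y, ⟨by positivity, (div_le_one h0).2 (by linarith)⟩, ?_, ?_⟩ <;>
      field_simp
    linarith

lemma GluingData.cnAt_of_left_mem {X₁ X₂ : Set α} (h : GluingData X₁ X₂) {y z w x : α} {t : ℝ}
    (ht : t ∈ Icc (0 : ℝ) 1) (hy : y ∈ X₁ ∩ X₂) (hz : z ∈ X₂)
    (hcn : ∀ x ∈ X₂, CNAt t y z w x) (hx : x ∈ X₁) : CNAt t y z w x := by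
  obtain ⟨b, hb, e⟩ := h.mixed x hx z hz
  obtain ⟨l, hl, e1, e2⟩ := exists_fraction e
  refine CNAt.of_subdivision ht hl e1 e2 (fun ρ hρ => ?_) (hcn b hb.2)
    ((hcn y hy.2).dist_left_le ht)
  obtain ⟨n, -, hn⟩ := h.inter y hy b hb ρ hρ
  exact ⟨n, hn _ (mem_univ _), hn _ (mem_univ _)⟩

lemma one_sub_mem {t : ℝ} (ht : t ∈ Icc (0 : ℝ) 1) : 1 - t ∈ Icc (0 : ℝ) 1 :=
  ⟨by linarith [ht.2], by linarith [ht.1]⟩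

lemma GluingData.cnAt_right {X₁ X₂ : Set α} (h : GluingData X₁ X₂) {y z w : α} {t : ℝ}
    (ht : t ∈ Icc (0 : ℝ) 1) (hy : y ∈ X₂) (hz : z ∈ X₂) (hw : w ∈ X₂)
    (hcn : ∀ x ∈ X₂, CNAt t y z w x) (x : α) : CNAt t y z w x := by
  rcases h.cover x with hx | hx
  swap
  · exact hcn x hx
  obtain ⟨b, hb, e⟩ := h.mixed x hx z hz
  obtain ⟨l, hl, e1, e2⟩ := exists_fraction e
  refine CNAt.of_subdivision ht hl e1 e2 (fun ρ hρ => ?_) (hcn b hb.2)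
    ((hcn y hy).dist_left_le ht)
  obtain ⟨n, -, hn⟩ := h.right b hb.2 y hy (1 - ρ) (one_sub_mem hρ)
  have e : 1 - (1 - ρ) = ρ := by ring
  refine ⟨n, ?_, ?_⟩
  · have := (h.cnAt_of_left_mem (one_sub_mem hρ) hb hy hn hx).swap
    rwa [e] at this
  · have := (hn w hw).swap
    rwa [e] at this

/-- First variation at a point of the intersection lying on a geodesic. -/
lemma GluingData.cnAt_inter {X₁ X₂ : Set α} (h : GluingData X₁ X₂) {y z a b : α} {τ : ℝ}
    (hτ : τ ∈ Icc (0 : ℝ) 1) (ha : a ∈ X₁ ∩ X₂) (hb : b ∈ X₁ ∩ X₂)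
    (h1 : dist y a = τ * dist y z) (h2 : dist a z = (1 - τ) * dist y z) : CNAt τ y z a b := by
  have key : ∀ κ : ℝ, 0 < κ → κ ≤ 1 → τ * (1 - τ) * dist y z ^ 2 + (1 - κ) * dist b a ^ 2 ≤
      (1 - τ) * dist b y ^ 2 + τ * dist b z ^ 2 := by
    intro κ hκ0 hκ1
    obtain ⟨c, -, hc⟩ := h.inter a ha b hb κ ⟨hκ0.le, hκ1⟩
    have hy := hc y (mem_univ _)
    have hz := hc z (mem_univ _)
    have hd := mul_sq_le_of_le_add hτ dist_nonneg (dist_triangle y c z)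
    unfold CNAt at hy hz
    rw [h1, dist_comm y b, dist_comm a b] at hy
    rw [dist_comm z c, dist_comm z a, dist_comm z b, h2, dist_comm a b] at hz
    have hy' := mul_le_mul_of_nonneg_left hy (sub_nonneg.2 hτ.2)
    have hz' := mul_le_mul_of_nonneg_left hz hτ.1
    refine le_of_mul_le_mul_left ?_ hκ0
    nlinarith
  unfold CNAt
  have hlim : Tendsto (fun κ : ℝ => τ * (1 - τ) * dist y z ^ 2 + (1 - κ) * dist b a ^ 2)
      (𝓝[>] 0) (𝓝 (τ * (1 - τ) * dist y z ^ 2 + (1 - 0) * dist b a ^ 2)) :=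
    (Continuous.tendsto (by fun_prop) 0).mono_left nhdsWithin_le_nhds
  have := le_of_tendsto hlim (by
    filter_upwards [Ioc_mem_nhdsGT (zero_lt_one' ℝ)] with κ hκ using key κ hκ.1 hκ.2)
  linarith

lemma GluingData.cnAt_mixed {X₁ X₂ : Set α} (h : GluingData X₁ X₂) {y z a x : α} {τ : ℝ}
    (hτ : τ ∈ Icc (0 : ℝ) 1) (hy : y ∈ X₁) (hz : z ∈ X₂) (ha : a ∈ X₁ ∩ X₂)
    (h1 : dist y a = τ * dist y z) (h2 : dist a z = (1 - τ) * dist y z) (hx : x ∈ X₁) :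
    CNAt τ y z a x := by
  obtain ⟨b, hb, e⟩ := h.mixed x hx z hz
  obtain ⟨l, hl, e1, e2⟩ := exists_fraction e
  refine CNAt.of_subdivision hτ hl e1 e2 (fun ρ hρ => ?_) (h.cnAt_inter hτ ha hb h1 h2) h1.le
  obtain ⟨n, -, hn⟩ := h.left y hy b hb.1 ρ hρ
  exact ⟨n, hn _ hx, hn _ ha.1⟩

lemma GluingData.exists_cnAt_mixed {X₁ X₂ : Set α} (h : GluingData X₁ X₂) {y z a : α} {τ t : ℝ}
    (hτ : τ ∈ Icc (0 : ℝ) 1) (hy : y ∈ X₁) (ha : a ∈ X₁ ∩ X₂)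
    (h1 : dist y a = τ * dist y z) (hcn : ∀ x, CNAt τ y z a x) (ht0 : 0 ≤ t) (ht : t ≤ τ) :
    ∃ w, ∀ x, CNAt t y z w x := by
  obtain ⟨s, hs, e⟩ : ∃ s ∈ Icc (0 : ℝ) 1, s * τ = t := by
    rcases hτ.1.eq_or_lt with h0 | h0
    · exact ⟨0, by simp, by linarith⟩
    · exact ⟨t / τ, ⟨by positivity, (div_le_one h0).2 ht⟩, by field_simp⟩
  obtain ⟨w, hw, hwcn⟩ := h.left y hy a ha.1 s hs
  refine ⟨w, fun x => ?_⟩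
  have k1 := h.swap.cnAt_right hs hy ha.1 hw hwcn x
  have k2 := hcn x
  unfold CNAt at *
  rw [h1] at k1
  have k3 := mul_le_mul_of_nonneg_left k2 hs.1
  subst e
  nlinarith

lemma GluingData.cnSet {X₁ X₂ : Set α} (h : GluingData X₁ X₂) : CNSet (univ : Set α) univ := by
  have same : ∀ {X₁ X₂ : Set α}, GluingData X₁ X₂ → ∀ y ∈ X₁, ∀ z ∈ X₁, ∀ t ∈ Icc (0 : ℝ) 1,
      ∃ w, ∀ x, CNAt t y z w x := by
    intro X₁ X₂ h y hy z hz t ht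
    obtain ⟨w, hw, hcn⟩ := h.left y hy z hz t ht
    exact ⟨w, h.swap.cnAt_right ht hy hz hw hcn⟩
  have mixed : ∀ {X₁ X₂ : Set α}, GluingData X₁ X₂ → ∀ y ∈ X₁, ∀ z ∈ X₂, ∀ t ∈ Icc (0 : ℝ) 1,
      ∃ w, ∀ x, CNAt t y z w x := by
    intro X₁ X₂ h y hy z hz t ht
    obtain ⟨a, ha, e⟩ := h.mixed y hy z hz
    obtain ⟨τ, hτ, e1, e2⟩ := exists_fraction e
    have e1' : dist z a = (1 - τ) * dist z y := by rw [dist_comm, e2, dist_comm y]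
    have e2' : dist a y = (1 - (1 - τ)) * dist z y := by
      rw [dist_comm, e1, dist_comm y]; ring
    have hcn : ∀ x, CNAt τ y z a x := by
      intro x
      rcases h.cover x with hx | hx
      · exact h.cnAt_mixed hτ hy hz ha e1 e2 hx
      · have := (h.swap.cnAt_mixed (one_sub_mem hτ) hz hy ha.symm e1' e2' hx).swap
        rwa [sub_sub_cancel] at this
    rcases le_total t τ with htτ | htτ
    · exact h.exists_cnAt_mixed hτ hy ha e1 hcn ht.1 htτ
    · obtain ⟨w, hw⟩ := h.swap.exists_cnAt_mixed (t := 1 - t) (one_sub_mem hτ) hz ha.symm e1'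
        (fun x => (hcn x).swap) (by linarith [ht.2]) (by linarith)
      refine ⟨w, fun x => ?_⟩
      have := (hw x).swap
      rwa [sub_sub_cancel] at this
  intro y _ z _ t ht
  have : ∃ w, ∀ x, CNAt t y z w x := by
    rcases h.cover y with hy | hy <;> rcases h.cover z with hz | hz
    · exact same h y hy z hz t ht
    · exact mixed h y hy z hz t ht
    · exact mixed h.swap y hy z hz t ht
    · exact same h.swap y hy z hz t ht
  obtain ⟨w, hw⟩ := this
  exact ⟨w, mem_univ _, fun x _ => hw x⟩

end Gluing

/-! ### Metric models of subsets of a product of trees -/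

section Models

variable {T₁ T₂ M : Type*} [MetricSpace T₁] [MetricSpace T₂] [MetricSpace M]

/-- The identity map from `T₁ × T₂` to the `ℓ²` product. -/
def toL (z : T₁ × T₂) : WithLp 2 (T₁ × T₂) := WithLp.toLp 2 z

lemma dist_toL (p q : T₁ × T₂) : dist (toL p) (toL q) = dist2 p q := by
  rw [WithLp.prod_dist_eq_add (by norm_num)]
  simp [toL, dist2, Real.sqrt_eq_rpow]

lemma edist_toL (p q : T₁ × T₂) : edist (toL p) (toL q) = ENNReal.ofReal (dist2 p q) := by
  rw [edist_dist, dist_toL]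

lemma dist2_le_add (p q : T₁ × T₂) : dist2 p q ≤ dist p.1 q.1 + dist p.2 q.2 := by
  unfold dist2
  refine Real.sqrt_le_iff.2 ⟨by positivity, ?_⟩
  nlinarith [dist_nonneg (x := p.1) (y := q.1), dist_nonneg (x := p.2) (y := q.2)]

lemma fst_le_dist2 (p q : T₁ × T₂) : dist p.1 q.1 ≤ dist2 p q :=
  Real.le_sqrt_of_sq_le (by nlinarith [sq_nonneg (dist p.2 q.2)])

lemma snd_le_dist2 (p q : T₁ × T₂) : dist p.2 q.2 ≤ dist2 p q :=
  Real.le_sqrt_of_sq_le (by nlinarith [sq_nonneg (dist p.1 q.1)])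

lemma dist2_swap (p q : T₁ × T₂) : dist2 p.swap q.swap = dist2 p q := by
  simp [dist2, add_comm]

/-- A metric space `M` over `T₁ × T₂` of non-positive curvature, with a distance lying between the
`ℓ²` and the `ℓ¹` distance. -/
structure IsCNModel (ι : M → T₁ × T₂) : Prop where
  lower : ∀ x y, dist2 (ι x) (ι y) ≤ dist x y
  upper : ∀ x y, dist x y ≤ dist (ι x).1 (ι y).1 + dist (ι x).2 (ι y).2
  cn : CNSet (univ : Set M) univ

/-- A model in which moreover distances are bounded by the `ℓ²` lengths of paths. -/
structure IsModel (ι : M → T₁ × T₂) : Prop extends IsCNModel ι where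
  path : ∀ (c : ℝ → M) (u v : ℝ), u ≤ v → ContinuousOn c (Icc u v) →
    edist (c u) (c v) ≤ eVariationOn (fun s => toL (ι (c s))) (Icc u v)

namespace IsCNModel

variable {ι : M → T₁ × T₂}

lemma swap (h : IsCNModel ι) : IsCNModel (fun m => (ι m).swap) where
  lower x y := by rw [dist2_swap]; exact h.lower x y
  upper x y := by rw [add_comm]; exact h.upper x y
  cn := h.cn

lemma fst_le (h : IsCNModel ι) (x y : M) : dist (ι x).1 (ι y).1 ≤ dist x y :=
  (fst_le_dist2 _ _).trans (h.lower x y)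

lemma snd_le (h : IsCNModel ι) (x y : M) : dist (ι x).2 (ι y).2 ≤ dist x y :=
  (snd_le_dist2 _ _).trans (h.lower x y)

lemma injective (h : IsCNModel ι) : Injective ι := fun x y e =>
  dist_eq_zero.1 (le_antisymm ((h.upper x y).trans (by simp [e])) dist_nonneg)

lemma continuous_fst (h : IsCNModel ι) : Continuous fun m => (ι m).1 :=
  (LipschitzWith.of_dist_le_mul (K := 1) fun x y => by simpa using h.fst_le x y).continuous

lemma continuous_snd (h : IsCNModel ι) : Continuous fun m => (ι m).2 :=
  (LipschitzWith.of_dist_le_mul (K := 1) fun x y => by simpa using h.snd_le x y).continuous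

lemma continuous (h : IsCNModel ι) : Continuous ι := h.continuous_fst.prodMk h.continuous_snd

lemma cnAt_of_mem_seg (h : IsCNModel ι) {y z w : M} (hw : w ∈ seg y z) :
    ∃ t ∈ Icc (0 : ℝ) 1, dist y w = t * dist y z ∧ dist w z = (1 - t) * dist y z ∧
      ∀ x, CNAt t y z w x := by
  obtain ⟨t, ht, e1, e2⟩ := exists_fraction (mem_seg.1 hw).symm
  obtain ⟨w', -, hw'⟩ := h.cn y (mem_univ _) z (mem_univ _) t ht
  have := (hw' w (mem_univ _)).eq_of_dist_le ht e1.le e2.le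
  subst this
  exact ⟨t, ht, e1, e2, fun x => hw' x (mem_univ _)⟩

lemma exists_geodesic (h : IsCNModel ι) (y z : M) : ∃ f : ℝ → M, f 0 = y ∧ f (dist y z) = z ∧
    ∀ s ∈ Icc (0 : ℝ) (dist y z), ∀ t ∈ Icc (0 : ℝ) (dist y z), dist (f s) (f t) = |s - t| := by
  rcases eq_or_ne y z with rfl | hyz
  · refine ⟨fun _ => y, rfl, rfl, fun s hs t ht => ?_⟩
    rw [dist_self] at hs ht ⊢
    rw [le_antisymm hs.2 hs.1, le_antisymm ht.2 ht.1]
    simp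
  have hD : 0 < dist y z := dist_pos.2 hyz
  have hmem : ∀ s ∈ Icc (0 : ℝ) (dist y z), s / dist y z ∈ Icc (0 : ℝ) 1 := fun s hs =>
    ⟨div_nonneg hs.1 hD.le, (div_le_one hD).2 hs.2⟩
  have hex : ∀ s : ℝ, ∃ w, s ∈ Icc (0 : ℝ) (dist y z) → ∀ x, CNAt (s / dist y z) y z w x := by
    intro s
    by_cases hs : s ∈ Icc (0 : ℝ) (dist y z)
    · obtain ⟨w, -, hw⟩ := h.cn y (mem_univ _) z (mem_univ _) _ (hmem s hs)
      exact ⟨w, fun _ x => hw x (mem_univ _)⟩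
    · exact ⟨y, fun h => absurd h hs⟩
  choose f hf using hex
  have hl : ∀ s ∈ Icc (0 : ℝ) (dist y z), dist y (f s) ≤ s := by
    intro s hs
    have := (hf s hs y).dist_left_le (hmem s hs)
    rwa [div_mul_cancel₀ _ hD.ne'] at this
  have hr : ∀ s ∈ Icc (0 : ℝ) (dist y z), dist (f s) z ≤ dist y z - s := by
    intro s hs
    have := (hf s hs z).dist_right_le (hmem s hs)
    rwa [sub_mul, div_mul_cancel₀ _ hD.ne', one_mul] at this
  have hle : ∀ s ∈ Icc (0 : ℝ) (dist y z), ∀ t ∈ Icc (0 : ℝ) (dist y z),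
      dist (f s) (f t) ≤ |s - t| := by
    intro s hs t ht
    have k := hf t ht (f s)
    unfold CNAt at k
    have k1 := pow_le_pow_left₀ dist_nonneg (hl s hs) 2
    have k2 := pow_le_pow_left₀ dist_nonneg (hr s hs) 2
    rw [dist_comm y (f s)] at k1
    obtain ⟨q, hq⟩ : ∃ q, q = t / dist y z := ⟨_, rfl⟩
    have hq1 := hmem t ht
    rw [← hq] at k hq1
    have hq2 : t = q * dist y z := by rw [hq, div_mul_cancel₀ _ hD.ne']
    have k1' := mul_le_mul_of_nonneg_left k1 (sub_nonneg.2 hq1.2)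
    have k2' := mul_le_mul_of_nonneg_left k2 hq1.1
    have : dist (f s) (f t) ^ 2 ≤ (s - t) ^ 2 := by rw [hq2]; rw [hq2] at k; nlinarith
    exact abs_le_of_sq_le_sq (by rwa [sq_abs]) (abs_nonneg _) |> (le_abs_self _).trans
  refine ⟨f, ?_, ?_, fun s hs t ht => le_antisymm (hle s hs t ht) (abs_le.2 ⟨?_, ?_⟩)⟩
  · exact (dist_eq_zero.1 (le_antisymm (hl 0 ⟨le_rfl, hD.le⟩) dist_nonneg)).symm
  · exact dist_eq_zero.1 (le_antisymm ((hr _ ⟨hD.le, le_rfl⟩).trans (by simp)) dist_nonneg)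
  · linarith [hl s hs, hr t ht, dist_triangle y (f s) z, dist_triangle (f s) (f t) z]
  · linarith [hl t ht, hr s hs, dist_triangle y (f t) z, dist_triangle (f t) (f s) z,
      dist_comm (f s) (f t)]

lemma exists_mem_seg_fst_eq (hT : IsRTree T₁) (h : IsCNModel ι) {x y : M} {a p : T₁}
    (hx : (ι x).1 ∈ dirAt a p) (hy : (ι y).1 ∉ dirAt a p) : ∃ w ∈ seg x y, (ι w).1 = a := by
  obtain ⟨f, hf0, hfD, hf⟩ := h.exists_geodesic x y
  by_contra! hno
  have hmem : ∀ s ∈ Icc (0 : ℝ) (dist x y), f s ∈ seg x y := by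
    intro s hs
    have := mem_seg_of_dist_eq hf le_rfl hs.1 hs.2 le_rfl
    rwa [hf0, hfD] at this
  have hc : ContinuousOn (fun s => (ι (f s)).1) (Icc 0 (dist x y)) :=
    h.continuous_fst.comp_continuousOn (continuousOn_of_dist_eq hf)
  have hpc := isPreconnected_Icc.image _ hc
  have hxa : (ι x).1 ≠ a := hno x (left_mem_seg _ _)
  have hsub := hpc.subset_connectedComponentIn (x := (ι x).1) (F := {a}ᶜ)
    ⟨0, ⟨le_rfl, dist_nonneg⟩, by simp [hf0]⟩ (by
      rintro _ ⟨s, hs, rfl⟩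
      exact hno _ (hmem s hs))
  rw [hT.connectedComponentIn_eq hxa, hT.dirAt_eq hx] at hsub
  exact hy (hsub ⟨dist x y, ⟨dist_nonneg, le_rfl⟩, by simp [hfD]⟩)

lemma exists_mem_seg_snd_eq (hT : IsRTree T₂) (h : IsCNModel ι) {x y : M} {a p : T₂}
    (hx : (ι x).2 ∈ dirAt a p) (hy : (ι y).2 ∉ dirAt a p) : ∃ w ∈ seg x y, (ι w).2 = a :=
  h.swap.exists_mem_seg_fst_eq hT hx hy

lemma fst_notMem_dirAt (hT : IsRTree T₁) (h : IsCNModel ι) {y z w : M} {a p : T₁}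
    (hy : (ι y).1 ∉ dirAt a p) (hz : (ι z).1 ∉ dirAt a p) (hw : w ∈ seg y z) :
    (ι w).1 ∉ dirAt a p := by
  intro hwa
  obtain ⟨u, hu, hua⟩ := h.exists_mem_seg_fst_eq hT hwa hy
  obtain ⟨v, hv, hva⟩ := h.exists_mem_seg_fst_eq hT hwa hz
  have hpos : 0 < dist (ι u).1 (ι w).1 := by
    rw [dist_pos, hua]
    rintro rfl
    exact not_mem_dirAt_self _ _ hwa
  have h1 : dist (ι u).2 (ι w).2 < dist u w := by
    refine lt_of_lt_of_le (Real.lt_sqrt_of_sq_lt ?_) (h.lower u w)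
    have := pow_pos hpos 2
    linarith
  have h2 := h.upper u v
  rw [hua, hva, dist_self, zero_add] at h2
  have h3 := dist_triangle (ι u).2 (ι w).2 (ι v).2
  have h4 := h.snd_le w v
  rw [mem_seg] at hu hv hw
  have h5 := dist_triangle4 y u v z
  rw [dist_comm w u, dist_comm u y, dist_comm w y] at hu
  linarith

lemma snd_notMem_dirAt (hT : IsRTree T₂) (h : IsCNModel ι) {y z w : M} {a p : T₂}
    (hy : (ι y).2 ∉ dirAt a p) (hz : (ι z).2 ∉ dirAt a p) (hw : w ∈ seg y z) :
    (ι w).2 ∉ dirAt a p :=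
  h.swap.fst_notMem_dirAt hT hy hz hw

lemma fst_mem_seg (hT : IsRTree T₁) (h : IsCNModel ι) {y z w : M} (hw : w ∈ seg y z) :
    (ι w).1 ∈ seg (ι y).1 (ι z).1 := by
  by_contra hno
  obtain ⟨r, hr, hy, hz⟩ := hT.exists_dirAt_of_not_mem_seg hno
  exact h.fst_notMem_dirAt hT hy hz hw (self_mem_dirAt hr)

lemma snd_mem_seg (hT : IsRTree T₂) (h : IsCNModel ι) {y z w : M} (hw : w ∈ seg y z) :
    (ι w).2 ∈ seg (ι y).2 (ι z).2 :=
  h.swap.fst_mem_seg hT hw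

lemma mem_seg_of_snd_eq (h : IsCNModel ι) {x k y : M} (hx : (ι x).2 = (ι k).2)
    (hy : (ι y).2 = (ι k).2) (hk : (ι k).1 ∈ seg (ι x).1 (ι y).1) : k ∈ seg x y := by
  have h1 := h.upper x k
  have h2 := h.upper k y
  have h3 := h.fst_le x y
  rw [hx, dist_self] at h1
  rw [hy, dist_self] at h2
  rw [mem_seg] at hk ⊢
  linarith [dist_triangle x k y]

end IsCNModel

/-- The CN inequality in a tree. -/
lemma IsRTree.cn (hT : IsRTree T₁) {y z w : T₁} {t : ℝ} (ht : t ∈ Icc (0 : ℝ) 1)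
    (h1 : dist y w = t * dist y z) (h2 : dist w z = (1 - t) * dist y z) (x : T₁) :
    CNAt t y z w x := by
  have key : ∀ {y z : T₁} {t : ℝ}, t ∈ Icc (0 : ℝ) 1 → dist y w = t * dist y z →
      dist w z = (1 - t) * dist y z → w ∈ seg y x → CNAt t y z w x := by
    intro y z t ht h1 h2 k
    rw [mem_seg, dist_comm y x, dist_comm w x, h1] at k
    have e : (dist x w - (1 - t) * dist y z) ^ 2 ≤ dist x z ^ 2 := by
      refine sq_le_sq' ?_ ?_ <;> rw [← h2]
      · linarith [dist_triangle w x z, dist_comm w x]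
      · linarith [dist_triangle x z w, dist_comm w z]
    have e' := mul_le_mul_of_nonneg_left e ht.1
    unfold CNAt
    rw [← k]
    nlinarith
  have hw : w ∈ seg y z := by rw [mem_seg, h1, h2]; ring
  rcases hT.mem_seg_or hw x with k | k
  · exact key ht h1 h2 k
  · rw [seg_symm] at k
    have := (key (one_sub_mem ht) (y := z) (z := y) (by rw [dist_comm z w, h2, dist_comm z])
      (by rw [dist_comm w y, h1, dist_comm z]; ring) k).swap
    rwa [sub_sub_cancel] at this

/-- The full product, with its `ℓ²` metric, is a model of itself. -/
lemma isModel_ofLp (hT₁ : IsRTree T₁) (hT₂ : IsRTree T₂) :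
    IsModel (fun m : WithLp 2 (T₁ × T₂) => m.ofLp) where
  lower x y := (dist_toL x.ofLp y.ofLp).ge
  upper x y := (dist_toL x.ofLp y.ofLp).le.trans (dist2_le_add _ _)
  cn := by
    intro y _ z _ t ht
    have hd : ∀ a b : WithLp 2 (T₁ × T₂),
        dist a b ^ 2 = dist a.ofLp.1 b.ofLp.1 ^ 2 + dist a.ofLp.2 b.ofLp.2 ^ 2 := fun a b => by
      rw [show dist a b = _ from dist_toL a.ofLp b.ofLp, dist2, Real.sq_sqrt (by positivity)]
    obtain ⟨w₁, hw₁, e₁, e₁'⟩ := hT₁.exists_mem_seg y.ofLp.1 z.ofLp.1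
      (mul_nonneg ht.1 dist_nonneg) (mul_le_of_le_one_left dist_nonneg ht.2)
    obtain ⟨w₂, hw₂, e₂, e₂'⟩ := hT₂.exists_mem_seg y.ofLp.2 z.ofLp.2
      (mul_nonneg ht.1 dist_nonneg) (mul_le_of_le_one_left dist_nonneg ht.2)
    refine ⟨toL (w₁, w₂), mem_univ _, fun x _ => ?_⟩
    have k₁ := hT₁.cn ht e₁ (by rw [e₁']; ring) x.ofLp.1
    have k₂ := hT₂.cn ht e₂ (by rw [e₂']; ring) x.ofLp.2
    unfold CNAt at *
    simp only [hd, toL]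
    linarith
  path c u v huv _ := eVariationOn.edist_le _ (left_mem_Icc.2 huv) (right_mem_Icc.2 huv)

end Models

/-! ### Removing a quadrant -/

section Prune

variable {M : Type*} [MetricSpace M]

lemma CNAt.dist_le {t : ℝ} (ht : t ∈ Icc (0 : ℝ) 1) {y z w x : M} (h : CNAt t y z w x) :
    dist x w ≤ (1 - t) * dist x y + t * dist x z := by
  unfold CNAt at h
  have h1 := mul_nonneg (sub_nonneg.2 ht.2) (dist_nonneg (x := x) (y := y))
  have h2 := mul_nonneg ht.1 (dist_nonneg (x := x) (y := z))
  have h3 : (dist x y - dist x z) ^ 2 ≤ dist y z ^ 2 :=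
    sq_le_sq' (by linarith [dist_triangle x y z]) (by linarith [dist_triangle x z y, dist_comm y z])
  have h4 := mul_le_mul_of_nonneg_left h3 (mul_nonneg ht.1 (sub_nonneg.2 ht.2))
  exact abs_le_of_sq_le_sq' (by nlinarith) (by linarith) |>.2

/-- `A ∪ B` as a bare type, to be endowed with the metric glued along `A ∩ B`. -/
@[ext]
structure Pruned (A B : Set M) where
  /-- The underlying point. -/
  val : M
  mem : val ∈ A ∨ val ∈ B

open Classical in
/-- The distance on `A ∪ B` glued along `A ∩ B`. -/
def prunedDist (A B : Set M) (x y : M) : ℝ :=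
  if x ∈ A ∧ y ∈ A ∨ x ∈ B ∧ y ∈ B then dist x y
  else sInf ((fun c => dist x c + dist c y) '' (A ∩ B))

/-- `A` and `B` are linked: shortest paths from `A` to `B` through `A ∩ B` exist. -/
def Linked (A B : Set M) : Prop :=
  ∀ x ∈ A, ∀ y ∈ B, ∃ c ∈ A ∩ B, ∀ c' ∈ A ∩ B, dist x c + dist c y ≤ dist x c' + dist c' y

variable {A B : Set M}

open Classical in
lemma prunedDist_comm (x y : M) : prunedDist A B x y = prunedDist A B y x := by
  unfold prunedDist
  have e : (fun c => dist x c + dist c y) = fun c => dist y c + dist c x := by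
    ext c
    rw [dist_comm x, dist_comm c y, add_comm]
  rw [dist_comm x, e]
  exact if_congr (by tauto) rfl rfl

lemma prunedDist_left {x y : M} (hx : x ∈ A) (hy : y ∈ A) : prunedDist A B x y = dist x y :=
  if_pos (Or.inl ⟨hx, hy⟩)

lemma prunedDist_right {x y : M} (hx : x ∈ B) (hy : y ∈ B) : prunedDist A B x y = dist x y :=
  if_pos (Or.inr ⟨hx, hy⟩)

lemma prunedDist_le {x y c : M} (hc : c ∈ A ∩ B) : prunedDist A B x y ≤ dist x c + dist c y := by
  unfold prunedDist
  split_ifs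
  · exact dist_triangle _ _ _
  · exact csInf_le ⟨0, by rintro _ ⟨c, -, rfl⟩; positivity⟩ ⟨c, hc, rfl⟩

lemma Linked.exists_prunedDist_eq (h : Linked A B) {x y : M} (hx : x ∈ A) (hy : y ∈ B) :
    ∃ c ∈ A ∩ B, prunedDist A B x y = dist x c + dist c y := by
  by_cases hxB : x ∈ B
  · exact ⟨x, ⟨hx, hxB⟩, by rw [prunedDist_right hxB hy, dist_self, zero_add]⟩
  by_cases hyA : y ∈ A
  · exact ⟨y, ⟨hyA, hy⟩, by rw [prunedDist_left hx hyA, dist_self, add_zero]⟩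
  obtain ⟨c, hc, hmin⟩ := h x hx y hy
  refine ⟨c, hc, ?_⟩
  rw [prunedDist, if_neg (by tauto)]
  exact IsLeast.csInf_eq ⟨⟨c, hc, rfl⟩, by rintro _ ⟨c', hc', rfl⟩; exact hmin c' hc'⟩

lemma Linked.dist_le_prunedDist (h : Linked A B) {x y : M} (hx : x ∈ A ∨ x ∈ B)
    (hy : y ∈ A ∨ y ∈ B) : dist x y ≤ prunedDist A B x y := by
  rcases hx with hx | hx <;> rcases hy with hy | hy
  · rw [prunedDist_left hx hy]
  · obtain ⟨c, -, e⟩ := h.exists_prunedDist_eq hx hy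
    rw [e]
    exact dist_triangle _ _ _
  · obtain ⟨c, -, e⟩ := h.exists_prunedDist_eq hy hx
    rw [prunedDist_comm, e, dist_comm x]
    exact dist_triangle _ _ _
  · rw [prunedDist_right hx hy]

lemma Linked.prunedDist_triangle (h : Linked A B) {x y z : M} (hx : x ∈ A ∨ x ∈ B)
    (hy : y ∈ A ∨ y ∈ B) (hz : z ∈ A ∨ z ∈ B) :
    prunedDist A B x z ≤ prunedDist A B x y + prunedDist A B y z := by
  have h0 : dist x z ≤ prunedDist A B x y + prunedDist A B y z :=
    (dist_triangle x y z).trans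
      (add_le_add (h.dist_le_prunedDist hx hy) (h.dist_le_prunedDist hy hz))
  have key : ∀ {x z : M}, x ∈ A → z ∈ B →
      prunedDist A B x z ≤ prunedDist A B x y + prunedDist A B y z := by
    intro x z hx hz
    rcases hy with hy | hy
    · obtain ⟨c, hc, e⟩ := h.exists_prunedDist_eq hy hz
      rw [prunedDist_left hx hy, e]
      linarith [prunedDist_le (x := x) (y := z) hc, dist_triangle x y c]
    · obtain ⟨c, hc, e⟩ := h.exists_prunedDist_eq hx hy
      rw [prunedDist_right hy hz, e]
      linarith [prunedDist_le (x := x) (y := z) hc, dist_triangle c y z]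
  rcases hx with hx | hx <;> rcases hz with hz | hz
  · rwa [prunedDist_left hx hz]
  · exact key hx hz
  · rw [prunedDist_comm x z, prunedDist_comm x y, prunedDist_comm y z, add_comm]
    exact key hz hx
  · rwa [prunedDist_right hx hz]

/-- The glued metric. -/
@[reducible]
def Linked.metricSpace (h : Linked A B) : MetricSpace (Pruned A B) where
  dist x y := prunedDist A B x.1 y.1
  dist_self x := by
    rcases x.2 with hx | hx
    · rw [prunedDist_left hx hx, dist_self]
    · rw [prunedDist_right hx hx, dist_self]
  dist_comm x y := prunedDist_comm _ _
  dist_triangle x y z := h.prunedDist_triangle x.2 y.2 z.2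
  eq_of_dist_eq_zero {x y} e := Pruned.ext (dist_eq_zero.1 (le_antisymm
    ((h.dist_le_prunedDist x.2 y.2).trans_eq e) dist_nonneg))

end Prune

section Sides

variable {M T₁ T₂ : Type*}

/-- The part of a model where the first coordinate is not in `dirAt a α`. -/
def fstSide [MetricSpace T₁] (ι : M → T₁ × T₂) (a α : T₁) : Set M := {m | (ι m).1 ∉ dirAt a α}

/-- The part of a model where the second coordinate is not in `dirAt b β`. -/
def sndSide [MetricSpace T₂] (ι : M → T₁ × T₂) (b β : T₂) : Set M := {m | (ι m).2 ∉ dirAt b β}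

lemma mem_fstSide [MetricSpace T₁] {ι : M → T₁ × T₂} {a α : T₁} {m : M} :
    m ∈ fstSide ι a α ↔ (ι m).1 ∉ dirAt a α := Iff.rfl

lemma mem_sndSide [MetricSpace T₂] {ι : M → T₁ × T₂} {b β : T₂} {m : M} :
    m ∈ sndSide ι b β ↔ (ι m).2 ∉ dirAt b β := Iff.rfl

variable [MetricSpace M] [MetricSpace T₁] [MetricSpace T₂]
variable {ι : M → T₁ × T₂} {a α : T₁} {b β : T₂}

lemma IsCNModel.linked (hT₁ : IsRTree T₁) (hT₂ : IsRTree T₂) (h : IsCNModel ι)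
    (hk : ∀ x y : M, (ι x).2 ∈ dirAt b β → (ι y).1 ∈ dirAt a α → x ∈ fstSide ι a α →
      y ∈ sndSide ι b β → ∃ k, ι k = (a, b)) :
    Linked (fstSide ι a α) (sndSide ι b β) := by
  intro x hx y hy
  by_cases hxB : (ι x).2 ∈ dirAt b β
  swap
  · exact ⟨x, ⟨hx, hxB⟩, fun c' _ => by rw [dist_self, zero_add]; exact dist_triangle _ _ _⟩
  by_cases hyA : (ι y).1 ∈ dirAt a α
  swap
  · exact ⟨y, ⟨hyA, hy⟩, fun c' _ => by rw [dist_self, add_zero]; exact dist_triangle _ _ _⟩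
  obtain ⟨k, hk⟩ := hk x y hxB hyA hx hy
  obtain ⟨s, hs, hsb⟩ := h.exists_mem_seg_snd_eq hT₂ hxB hy
  by_cases hsA : (ι s).1 ∈ dirAt a α
  swap
  · refine ⟨s, ⟨hsA, by rw [mem_sndSide, hsb]; exact not_mem_dirAt_self _ _⟩, fun c' _ => ?_⟩
    rw [mem_seg.1 hs]
    exact dist_triangle _ _ _
  refine ⟨k, ⟨?_, ?_⟩, fun c' hc' => ?_⟩
  · rw [mem_fstSide, hk]; exact not_mem_dirAt_self _ _
  · rw [mem_sndSide, hk]; exact not_mem_dirAt_self _ _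
  obtain ⟨u, hu, hub⟩ := h.exists_mem_seg_snd_eq hT₂ hxB hc'.2
  have huA := h.fst_notMem_dirAt hT₁ hx hc'.1 hu
  have hks : k ∈ seg u s := by
    refine h.mem_seg_of_snd_eq (by rw [hub, hk]) (by rw [hsb, hk]) ?_
    rw [hk, seg_symm]
    exact hT₁.mem_seg_of_mem_dirAt hsA huA
  obtain ⟨t, ht, -, -, hcn⟩ := h.cnAt_of_mem_seg hks
  have k1 := (hcn x).dist_le ht
  have k2 := (hcn y).dist_le ht
  rw [mem_seg] at hs hu
  have k3 := dist_triangle u c' y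
  have k4 := dist_triangle x u y
  have k5 := mul_nonneg ht.1 (sub_nonneg.2 k4)
  rw [dist_comm k y]
  rw [← hs, dist_comm u y, dist_comm s y] at k5
  rw [dist_comm u y] at k3
  linarith

lemma IsCNModel.gluingData (hT₁ : IsRTree T₁) (hT₂ : IsRTree T₂) (h : IsCNModel ι)
    (hl : Linked (fstSide ι a α) (sndSide ι b β)) :
    letI := hl.metricSpace
    GluingData {m : Pruned (fstSide ι a α) (sndSide ι b β) | m.1 ∈ fstSide ι a α}
      {m | m.1 ∈ sndSide ι b β} := by
  let := hl.metricSpace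
  have hdist : ∀ x y : Pruned (fstSide ι a α) (sndSide ι b β),
      dist x y = prunedDist (fstSide ι a α) (sndSide ι b β) x.1 y.1 := fun _ _ => rfl
  have hA : ∀ x y : Pruned (fstSide ι a α) (sndSide ι b β), x.1 ∈ fstSide ι a α →
      y.1 ∈ fstSide ι a α → dist x y = dist x.1 y.1 := fun _ _ h1 h2 => prunedDist_left h1 h2
  have hB : ∀ x y : Pruned (fstSide ι a α) (sndSide ι b β), x.1 ∈ sndSide ι b β →
      y.1 ∈ sndSide ι b β → dist x y = dist x.1 y.1 := fun _ _ h1 h2 => prunedDist_right h1 h2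
  have hseg : ∀ {y z w : M} {t : ℝ}, t ∈ Icc (0 : ℝ) 1 → (∀ x, CNAt t y z w x) →
      w ∈ seg y z := by
    intro y z w t ht hcn
    rw [mem_seg]
    linarith [dist_triangle y w z, (hcn y).dist_left_le ht, (hcn z).dist_right_le ht]
  constructor
  · exact fun x => x.2
  · intro y hy z hz t ht
    obtain ⟨w, -, hcn⟩ := h.cn y.1 (mem_univ _) z.1 (mem_univ _) t ht
    have hw : w ∈ fstSide ι a α :=
      h.fst_notMem_dirAt hT₁ hy hz (hseg ht fun x => hcn x (mem_univ _))
    refine ⟨⟨w, Or.inl hw⟩, hw, fun x hx => ?_⟩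
    have := hcn x.1 (mem_univ _)
    unfold CNAt at *
    rwa [hA x _ hx hw, hA x y hx hy, hA x z hx hz, hA y z hy hz]
  · intro y hy z hz t ht
    obtain ⟨w, -, hcn⟩ := h.cn y.1 (mem_univ _) z.1 (mem_univ _) t ht
    have hw : w ∈ sndSide ι b β :=
      h.snd_notMem_dirAt hT₂ hy hz (hseg ht fun x => hcn x (mem_univ _))
    refine ⟨⟨w, Or.inr hw⟩, hw, fun x hx => ?_⟩
    have := hcn x.1 (mem_univ _)
    unfold CNAt at *
    rwa [hB x _ hx hw, hB x y hx hy, hB x z hx hz, hB y z hy hz]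
  · intro y hy z hz t ht
    obtain ⟨w, -, hcn⟩ := h.cn y.1 (mem_univ _) z.1 (mem_univ _) t ht
    have hw := hseg ht fun x => hcn x (mem_univ _)
    have hwA : w ∈ fstSide ι a α := h.fst_notMem_dirAt hT₁ hy.1 hz.1 hw
    have hwB : w ∈ sndSide ι b β := h.snd_notMem_dirAt hT₂ hy.2 hz.2 hw
    refine ⟨⟨w, Or.inl hwA⟩, ⟨hwA, hwB⟩, fun x _ => ?_⟩
    have := hcn x.1 (mem_univ _)
    unfold CNAt at *
    rcases x.2 with hx | hx
    · rwa [hA x _ hx hwA, hA x y hx hy.1, hA x z hx hz.1, hA y z hy.1 hz.1]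
    · rwa [hB x _ hx hwB, hB x y hx hy.2, hB x z hx hz.2, hB y z hy.2 hz.2]
  · intro x hx y hy
    obtain ⟨c, hc, e⟩ := hl.exists_prunedDist_eq hx hy
    refine ⟨⟨c, Or.inl hc.1⟩, hc, ?_⟩
    rw [hA x ⟨c, Or.inl hc.1⟩ hx hc.1, hB ⟨c, Or.inl hc.1⟩ y hc.2 hy]
    exact e

lemma IsModel.pruned (hT₁ : IsRTree T₁) (hT₂ : IsRTree T₂) (h : IsModel ι)
    (hk : ∀ x y : M, (ι x).2 ∈ dirAt b β → (ι y).1 ∈ dirAt a α → x ∈ fstSide ι a α →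
      y ∈ sndSide ι b β → ∃ k, ι k = (a, b))
    (hl : Linked (fstSide ι a α) (sndSide ι b β)) :
    letI := hl.metricSpace
    IsModel (fun m : Pruned (fstSide ι a α) (sndSide ι b β) => ι m.1) := by
  let := hl.metricSpace
  have hdist : ∀ x y : Pruned (fstSide ι a α) (sndSide ι b β),
      dist x y = prunedDist (fstSide ι a α) (sndSide ι b β) x.1 y.1 := fun _ _ => rfl
  have hle : ∀ x y : Pruned (fstSide ι a α) (sndSide ι b β), dist x.1 y.1 ≤ dist x y :=
    fun x y => hl.dist_le_prunedDist x.2 y.2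
  have hcont : Continuous fun m : Pruned (fstSide ι a α) (sndSide ι b β) => m.1 :=
    (LipschitzWith.of_dist_le_mul (K := 1) fun x y => by simpa using hle x y).continuous
  constructor
  · constructor
    · exact fun x y => (h.lower _ _).trans (hle x y)
    · have key : ∀ x y : M, x ∈ fstSide ι a α → y ∈ sndSide ι b β →
          prunedDist (fstSide ι a α) (sndSide ι b β) x y ≤
            dist (ι x).1 (ι y).1 + dist (ι x).2 (ι y).2 := by
        intro x y hx hy
        by_cases hxB : (ι x).2 ∈ dirAt b β
        swap
        · rw [prunedDist_right hxB hy]; exact h.upper _ _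
        by_cases hyA : (ι y).1 ∈ dirAt a α
        swap
        · rw [prunedDist_left hx hyA]; exact h.upper _ _
        obtain ⟨k, hk⟩ := hk x y hxB hyA hx hy
        have hkm : k ∈ fstSide ι a α ∩ sndSide ι b β := by
          constructor
          · rw [mem_fstSide, hk]; exact not_mem_dirAt_self _ _
          · rw [mem_sndSide, hk]; exact not_mem_dirAt_self _ _
        have e1 := hT₁.mem_seg_of_mem_dirAt hyA hx
        have e2 := hT₂.mem_seg_of_mem_dirAt hxB hy
        rw [seg_symm] at e1
        rw [mem_seg] at e1 e2
        have k1 := h.upper x k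
        have k2 := h.upper k y
        rw [hk] at k1 k2
        linarith [prunedDist_le (x := x) (y := y) hkm]
      intro x y
      rw [hdist]
      rcases x.2 with hx | hx <;> rcases y.2 with hy | hy
      · rw [prunedDist_left hx hy]; exact h.upper _ _
      · exact key _ _ hx hy
      · rw [prunedDist_comm, dist_comm (ι x.1).1, dist_comm (ι x.1).2]; exact key _ _ hy hx
      · rw [prunedDist_right hx hy]; exact h.upper _ _
    · exact (h.toIsCNModel.gluingData hT₁ hT₂ hl).cnSet
  · intro c u v huv hc
    have hc' : ContinuousOn (fun s => (c s).1) (Icc u v) := hcont.comp_continuousOn hc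
    have hsame : dist (c u) (c v) = dist (c u).1 (c v).1 →
        edist (c u) (c v) ≤ eVariationOn (fun s => toL (ι (c s).1)) (Icc u v) := by
      intro e
      rw [edist_dist, e, ← edist_dist]
      exact h.path _ u v huv hc'
    have hmixed : ∀ s ∈ Icc u v, (c s).1 ∈ fstSide ι a α ∩ sndSide ι b β →
        edist (c u) (c v) ≤ eVariationOn (fun s => toL (ι (c s).1)) (Icc u v) := by
      intro s hs hsm
      have e := eVariationOn.Icc_add_Icc (s := univ) (fun s => toL (ι (c s).1)) hs.1 hs.2
        (mem_univ _)
      simp only [univ_inter] at e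
      rw [← e]
      refine le_trans ?_ (add_le_add
        (h.path _ u s hs.1 (hc'.mono (Icc_subset_Icc_right hs.2)))
        (h.path _ s v hs.2 (hc'.mono (Icc_subset_Icc_left hs.1))))
      rw [edist_dist, edist_dist, edist_dist, ← ENNReal.ofReal_add dist_nonneg dist_nonneg]
      exact ENNReal.ofReal_le_ofReal (prunedDist_le hsm)
    have hclA : IsClosed (fstSide ι a α) :=
      (isClosed_compl_dirAt a α).preimage h.continuous_fst
    have hclB : IsClosed (sndSide ι b β) :=
      (isClosed_compl_dirAt b β).preimage h.continuous_snd
    have hcross : ((fun s => (c s).1) '' Icc u v ∩ fstSide ι a α).Nonempty →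
        ((fun s => (c s).1) '' Icc u v ∩ sndSide ι b β).Nonempty →
        edist (c u) (c v) ≤ eVariationOn (fun s => toL (ι (c s).1)) (Icc u v) := by
      intro h1 h2
      obtain ⟨_, ⟨s, hs, rfl⟩, hsm⟩ := isPreconnected_closed_iff.1
        (isPreconnected_Icc.image _ hc') _ _ hclA hclB
        (by rintro _ ⟨s, -, rfl⟩; exact (c s).2) h1 h2
      exact hmixed s hs hsm
    have hu : (c u).1 ∈ (fun s => (c s).1) '' Icc u v := ⟨u, left_mem_Icc.2 huv, rfl⟩
    have hv : (c v).1 ∈ (fun s => (c s).1) '' Icc u v := ⟨v, right_mem_Icc.2 huv, rfl⟩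
    rcases (c u).2 with hx | hx <;> rcases (c v).2 with hy | hy
    · exact hsame (prunedDist_left hx hy)
    · exact hcross ⟨_, hu, hx⟩ ⟨_, hv, hy⟩
    · exact hcross ⟨_, hv, hy⟩ ⟨_, hu, hx⟩
    · exact hsame (prunedDist_right hx hy)

end Sides

/-! ### Directed intersections of models -/

section Limits

universe u v

variable {T₁ : Type u} {T₂ : Type v} [MetricSpace T₁] [MetricSpace T₂]

/-- Distances increase when the range of a model shrinks. -/
lemma IsModel.dist_le_dist {M M' : Type*} [MetricSpace M] [MetricSpace M'] {ι : M → T₁ × T₂}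
    {ι' : M' → T₁ × T₂} (h : IsModel ι) (h' : IsCNModel ι') (hr : range ι' ⊆ range ι)
    {y z : M} {y' z' : M'} (hy : ι y = ι' y') (hz : ι z = ι' z') : dist y z ≤ dist y' z' := by
  obtain ⟨f, hf0, hfD, hf⟩ := h'.exists_geodesic y' z'
  choose c hc using fun s => hr (mem_range_self (f s))
  have hlip : LipschitzOnWith 1 (fun s => toL (ι (c s))) (Icc 0 (dist y' z')) := by
    refine LipschitzOnWith.of_dist_le_mul fun s hs t ht => ?_
    rw [dist_toL, hc, hc, NNReal.coe_one, one_mul, Real.dist_eq, ← hf s hs t ht]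
    exact h'.lower _ _
  have hcont : ContinuousOn c (Icc 0 (dist y' z')) := by
    refine (LipschitzOnWith.of_dist_le_mul (K := 2) fun s hs t ht => ?_).continuousOn
    refine (h.upper _ _).trans ?_
    rw [hc, hc, NNReal.coe_ofNat, Real.dist_eq, ← hf s hs t ht]
    linarith [h'.fst_le (f s) (f t), h'.snd_le (f s) (f t)]
  have h0 : c 0 = y := h.injective (by rw [hc, hf0, hy])
  have hD : c (dist y' z') = z := h.injective (by rw [hc, hfD, hz])
  have k := h.path c 0 (dist y' z') dist_nonneg hcont
  rw [h0, hD, edist_dist] at k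
  have k2 := hlip.comp_eVariationOn_le (g := id) (s := Icc 0 (dist y' z')) fun _ hs => hs
  have k3 := monotoneOn_id.eVariationOn_eq (s := Icc 0 (dist y' z'))
    (left_mem_Icc.2 dist_nonneg) (right_mem_Icc.2 dist_nonneg)
  rw [inter_self] at k3
  rw [ENNReal.coe_one, one_mul] at k2
  have := k.trans (k2.trans_eq k3)
  rwa [id, id, sub_zero, ENNReal.ofReal_le_ofReal_iff dist_nonneg] at this

/-- A model with prescribed range. -/
structure Model (X : Set (T₁ × T₂)) where
  /-- The underlying type. -/
  carrier : Type (max u v)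
  [ms : MetricSpace carrier]
  /-- The map to the product. -/
  map : carrier → T₁ × T₂
  good : IsModel map
  range_eq : range map = X

attribute [instance] Model.ms

namespace Model

variable {X : Set (T₁ × T₂)}

lemma map_mem (m : Model X) (x : m.carrier) : m.map x ∈ X := 
  m.range_eq.subset (mem_range_self x)

lemma exists_map_eq (m : Model X) {p : T₁ × T₂} (hp : p ∈ X) : ∃ x, m.map x = p := by
  rwa [← m.range_eq] at hp

/-- The point of a model above a given point. -/
def lift (m : Model X) (p : T₁ × T₂) (hp : p ∈ X) : m.carrier :=
  (m.exists_map_eq hp).choose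

@[simp]
lemma map_lift (m : Model X) (p : T₁ × T₂) (hp : p ∈ X) : m.map (m.lift p hp) = p :=
  (m.exists_map_eq hp).choose_spec

lemma dist_le_dist {X' : Set (T₁ × T₂)} (m : Model X) (m' : Model X') (h : X' ⊆ X)
    {y z : m.carrier} {y' z' : m'.carrier} (hy : m.map y = m'.map y')
    (hz : m.map z = m'.map z') : dist y z ≤ dist y' z' :=
  m.good.dist_le_dist m'.good.toIsCNModel (by rwa [m.range_eq, m'.range_eq]) hy hz

end Model

variable {I : Type*} {X : I → Set (T₁ × T₂)}

/-- The intersection of the family `X` as a bare type. -/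
@[ext]
structure LimitSpace (X : I → Set (T₁ × T₂)) where
  /-- The underlying point. -/
  val : T₁ × T₂
  mem : ∀ i, val ∈ X i

/-- The point of the model of `X i` above a point of the limit. -/
def LimitSpace.toModel (m : ∀ i, Model (X i)) (x : LimitSpace X) (i : I) : (m i).carrier :=
  (m i).lift x.val (x.mem i)

@[simp]
lemma LimitSpace.map_toModel (m : ∀ i, Model (X i)) (x : LimitSpace X) (i : I) :
    (m i).map (x.toModel m i) = x.val := (m i).map_lift _ _

/-- The supremum of the distances in the models. -/
def limitDist (m : ∀ i, Model (X i)) (x y : LimitSpace X) : ℝ :=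
  ⨆ i, dist (x.toModel m i) (y.toModel m i)

variable (m : ∀ i, Model (X i))

lemma dist_toModel_le_add (x y : LimitSpace X) (i : I) : dist (x.toModel m i) (y.toModel m i) ≤
    dist x.val.1 y.val.1 + dist x.val.2 y.val.2 := by
  simpa using (m i).good.upper (x.toModel m i) (y.toModel m i)

lemma bddAbove_dist_toModel (x y : LimitSpace X) :
    BddAbove (range fun i => dist (x.toModel m i) (y.toModel m i)) :=
  ⟨_, by rintro _ ⟨i, rfl⟩; exact dist_toModel_le_add m x y i⟩

lemma dist_toModel_le (x y : LimitSpace X) (i : I) :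
    dist (x.toModel m i) (y.toModel m i) ≤ limitDist m x y :=
  le_ciSup (bddAbove_dist_toModel m x y) i

lemma tendsto_dist_toModel [Preorder I] (hX : Antitone X) (x y : LimitSpace X) :
    Tendsto (fun i => dist (x.toModel m i) (y.toModel m i)) atTop (𝓝 (limitDist m x y)) :=
  tendsto_atTop_ciSup (fun i j hij => (m i).dist_le_dist (m j) (hX hij) (by simp) (by simp))
    (bddAbove_dist_toModel m x y)

variable [Nonempty I]

/-- The limit metric. -/
@[reducible]
def limitMetricSpace : MetricSpace (LimitSpace X) where
  dist := limitDist m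
  dist_self x := by simp [limitDist]
  dist_comm x y := by simp only [limitDist, dist_comm]
  dist_triangle x y z := ciSup_le fun i => (dist_triangle _ (y.toModel m i) _).trans
    (add_le_add (dist_toModel_le m x y i) (dist_toModel_le m y z i))
  eq_of_dist_eq_zero {x y} e := by
    obtain ⟨i⟩ := ‹Nonempty I›
    have := dist_eq_zero.1 (le_antisymm ((dist_toModel_le m x y i).trans_eq e) dist_nonneg)
    have := congrArg (m i).map this
    simp only [LimitSpace.map_toModel] at this
    exact LimitSpace.ext this

variable [Preorder I] [IsDirectedOrder I]

lemma exists_limit_point (hT₁ : IsRTree T₁) (hT₂ : IsRTree T₂) (hX : Antitone X)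
    (hcl : ∀ i, IsClosed (X i)) (y z : LimitSpace X) {t : ℝ} (ht : t ∈ Icc (0 : ℝ) 1) :
    ∃ w : LimitSpace X, limitDist m y w ≤ t * limitDist m y z ∧
      limitDist m w z ≤ (1 - t) * limitDist m y z := by
  choose w _ hw using fun i => (m i).good.cn (y.toModel m i) (mem_univ _) (z.toModel m i)
    (mem_univ _) t ht
  have hwl := fun i => (hw i _ (mem_univ _)).dist_left_le ht
  have hwr := fun i => (hw i _ (mem_univ _)).dist_right_le ht
  have hK : ∀ i, (m i).map (w i) ∈ seg y.val.1 z.val.1 ×ˢ seg y.val.2 z.val.2 := by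
    intro i
    have hs : w i ∈ seg (y.toModel m i) (z.toModel m i) := by
      rw [mem_seg]
      linarith [dist_triangle (y.toModel m i) (w i) (z.toModel m i), hwl i, hwr i]
    have h1 := (m i).good.fst_mem_seg hT₁ hs
    have h2 := (m i).good.snd_mem_seg hT₂ hs
    simp only [LimitSpace.map_toModel] at h1 h2
    exact ⟨h1, h2⟩
  obtain ⟨p, -, hp⟩ := ((hT₁.isCompact_seg y.val.1 z.val.1).prod
    (hT₂.isCompact_seg y.val.2 z.val.2)).ultrafilter_le_nhds
    ((Ultrafilter.of (atTop : Filter I)).map fun i => (m i).map (w i))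
    (le_principal_iff.2 (Eventually.of_forall hK : ∀ᶠ i in _, _))
  have hlim : Tendsto (fun i => (m i).map (w i)) (Ultrafilter.of (atTop : Filter I)) (𝓝 p) := hp
  have hev : ∀ j, ∀ᶠ i in (Ultrafilter.of (atTop : Filter I) : Filter I), j ≤ i := fun j =>
    Ultrafilter.of_le _ (eventually_ge_atTop j)
  have hpX : ∀ i, p ∈ X i := fun j => (hcl j).mem_of_tendsto hlim
    ((hev j).mono fun i hi => hX hi ((m i).map_mem _))
  refine ⟨⟨p, hpX⟩, ?_, ?_⟩
  all_goals refine ciSup_le fun j => ?_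
  all_goals
    have hlim2 : Tendsto (fun i => dist ((m i).map (w i)).1 p.1 + dist ((m i).map (w i)).2 p.2)
        (Ultrafilter.of (atTop : Filter I)) (𝓝 0) := by
      have h1 := (continuous_fst.tendsto p).comp hlim
      have h2 := (continuous_snd.tendsto p).comp hlim
      simpa using (h1.dist (tendsto_const_nhds (x := p.1))).add
        (h2.dist (tendsto_const_nhds (x := p.2)))
  · have hlim3 := hlim2.const_add (t * limitDist m y z)
    rw [add_zero] at hlim3
    refine ge_of_tendsto hlim3 ((hev j).mono fun i hi => ?_)
    have h1 := (m j).dist_le_dist (m i) (hX hi) (y := y.toModel m j)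
      (z := (m j).lift _ (hX hi ((m i).map_mem (w i)))) (y' := y.toModel m i) (z' := w i)
      (by simp) (by simp)
    refine (dist_triangle _ ((m j).lift _ (hX hi ((m i).map_mem (w i)))) _).trans
      (add_le_add (h1.trans ((hwl i).trans
        (mul_le_mul_of_nonneg_left (dist_toModel_le m y z i) ht.1))) ?_)
    simpa [LimitSpace.toModel] using (m j).good.upper
      ((m j).lift _ (hX hi ((m i).map_mem (w i)))) (LimitSpace.toModel m ⟨p, hpX⟩ j)
  · have hlim3 := hlim2.add_const ((1 - t) * limitDist m y z)
    rw [zero_add] at hlim3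
    refine ge_of_tendsto hlim3 ((hev j).mono fun i hi => ?_)
    have h1 := (m j).dist_le_dist (m i) (hX hi) (z := z.toModel m j)
      (y := (m j).lift _ (hX hi ((m i).map_mem (w i)))) (z' := z.toModel m i) (y' := w i)
      (by simp) (by simp)
    refine (dist_triangle _ ((m j).lift _ (hX hi ((m i).map_mem (w i)))) _).trans
      (add_le_add ?_ (h1.trans ((hwr i).trans
        (mul_le_mul_of_nonneg_left (dist_toModel_le m y z i) (sub_nonneg.2 ht.2)))))
    rw [dist_comm]
    simpa [LimitSpace.toModel] using (m j).good.upper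
      ((m j).lift _ (hX hi ((m i).map_mem (w i)))) (LimitSpace.toModel m ⟨p, hpX⟩ j)

/-- A point which is almost at fraction `t` satisfies the CN inequality in the limit. -/
lemma cn_limit (hX : Antitone X) {x y z w : LimitSpace X} {t : ℝ} (ht : t ∈ Icc (0 : ℝ) 1)
    (h1 : limitDist m y w ≤ t * limitDist m y z)
    (h2 : limitDist m w z ≤ (1 - t) * limitDist m y z) :
    limitDist m x w ^ 2 ≤ (1 - t) * limitDist m x y ^ 2 + t * limitDist m x z ^ 2 -
      t * (1 - t) * limitDist m y z ^ 2 := by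
  choose v _ hv using fun i => (m i).good.cn (y.toModel m i) (mem_univ _) (z.toModel m i)
    (mem_univ _) t ht
  have lim := tendsto_dist_toModel m hX
  let R : I → ℝ := fun i => (1 - t) * dist (x.toModel m i) (y.toModel m i) ^ 2 +
    t * dist (x.toModel m i) (z.toModel m i) ^ 2 -
    t * (1 - t) * dist (y.toModel m i) (z.toModel m i) ^ 2
  let S : I → ℝ := fun i =>
    t * (1 - t) * (limitDist m y z ^ 2 - dist (y.toModel m i) (z.toModel m i) ^ 2)
  have hR : Tendsto R atTop (𝓝 ((1 - t) * limitDist m x y ^ 2 + t * limitDist m x z ^ 2 -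
      t * (1 - t) * limitDist m y z ^ 2)) :=
    ((((lim x y).pow 2).const_mul _).add (((lim x z).pow 2).const_mul _)).sub
      (((lim y z).pow 2).const_mul _)
  have hS : Tendsto S atTop (𝓝 0) := by
    have := (((lim y z).pow 2).const_sub (limitDist m y z ^ 2)).const_mul (t * (1 - t))
    rwa [sub_self, mul_zero] at this
  have hRi : ∀ i, dist (x.toModel m i) (v i) ^ 2 ≤ R i := fun i => hv i _ (mem_univ _)
  have hSi : ∀ i, dist (w.toModel m i) (v i) ^ 2 ≤ S i := by
    intro i
    have k := hv i (w.toModel m i) (mem_univ _)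
    unfold CNAt at k
    have k1 := pow_le_pow_left₀ dist_nonneg ((dist_toModel_le m y w i).trans h1) 2
    have k2 := pow_le_pow_left₀ dist_nonneg ((dist_toModel_le m w z i).trans h2) 2
    rw [dist_comm] at k1
    have k1' := mul_le_mul_of_nonneg_left k1 (sub_nonneg.2 ht.2)
    have k2' := mul_le_mul_of_nonneg_left k2 ht.1
    simp only [S]
    linarith
  have hle : ∀ i, dist (x.toModel m i) (w.toModel m i) ≤ √(R i) + √(S i) := fun i =>
    (dist_triangle_right _ _ (v i)).trans
      (add_le_add (Real.le_sqrt_of_sq_le (hRi i)) (Real.le_sqrt_of_sq_le (hSi i)))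
  have key := le_of_tendsto_of_tendsto' (lim x w) (hR.sqrt.add hS.sqrt) hle
  rw [Real.sqrt_zero, add_zero] at key
  refine (pow_le_pow_left₀ (ge_of_tendsto' (lim x w) fun _ => dist_nonneg) key 2).trans_eq
    (Real.sq_sqrt (ge_of_tendsto' hR fun i => (sq_nonneg _).trans (hRi i)))

lemma isModel_limit (hT₁ : IsRTree T₁) (hT₂ : IsRTree T₂) (hX : Antitone X)
    (hcl : ∀ i, IsClosed (X i)) :
    letI := limitMetricSpace m
    IsModel (LimitSpace.val : LimitSpace X → T₁ × T₂) := by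
  let := limitMetricSpace m
  have hdist : ∀ x y : LimitSpace X, dist x y = limitDist m x y := fun _ _ => rfl
  constructor
  · constructor
    · intro x y
      obtain ⟨i⟩ := ‹Nonempty I›
      refine le_trans ?_ (dist_toModel_le m x y i)
      simpa using (m i).good.lower (x.toModel m i) (y.toModel m i)
    · exact fun x y => ciSup_le (dist_toModel_le_add m x y)
    · intro y _ z _ t ht
      obtain ⟨w, hw1, hw2⟩ := exists_limit_point m hT₁ hT₂ hX hcl y z ht
      exact ⟨w, mem_univ _, fun x _ => cn_limit m hX ht hw1 hw2⟩
  · intro c a b hab hc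
    have lim := (ENNReal.continuous_ofReal.tendsto _).comp
      (tendsto_dist_toModel m hX (c a) (c b))
    rw [edist_dist, hdist]
    refine le_of_tendsto' lim fun i => ?_
    have hlip : LipschitzWith 1 fun x : LimitSpace X => x.toModel m i :=
      LipschitzWith.of_dist_le_mul fun x y => by
        rw [NNReal.coe_one, one_mul]
        exact dist_toModel_le m x y i
    have := (m i).good.path (fun s => (c s).toModel m i) a b hab
      (hlip.continuous.comp_continuousOn hc)
    simpa [edist_dist] using this

end Limits

/-! ### Complements of quadrants -/

section Complements

universe u v

variable {T₁ : Type u} {T₂ : Type v} [MetricSpace T₁] [MetricSpace T₂]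

/-- The quadrant based at `q.1` containing `q.2`. -/
def quad (q : (T₁ × T₂) × (T₁ × T₂)) : Set (T₁ × T₂) := dirAt q.1.1 q.2.1 ×ˢ dirAt q.1.2 q.2.2

/-- `E` is a complement of quadrants, and no quadrant in the complement of `E` faces a quadrant in
the complement of `E`. -/
structure IsQuadComplement (E : Set (T₁ × T₂)) : Prop where
  exists_quad : ∀ z ∉ E, ∃ q, z ∈ quad q ∧ Disjoint E (quad q)
  exists_mem : ∀ q, (quad q).Nonempty → Disjoint E (quad q) →
    ∃ z ∈ E, z.1 ∉ dirAt q.1.1 q.2.1 ∧ z.2 ∉ dirAt q.1.2 q.2.2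

variable {E : Set (T₁ × T₂)}

/-- The complement of a finite family of quadrants disjoint from `E`. -/
def outside (F : Finset {q : (T₁ × T₂) × (T₁ × T₂) // Disjoint E (quad q)}) : Set (T₁ × T₂) :=
  {z | ∀ q ∈ F, z ∉ quad q.1}

lemma subset_outside (F : Finset {q : (T₁ × T₂) × (T₁ × T₂) // Disjoint E (quad q)}) :
    E ⊆ outside F := fun _ hz q _ hq => disjoint_left.1 q.2 hz hq

lemma antitone_outside : Antitone (outside (E := E)) := fun _ _ h _ hz q hq => hz q (h hq)

lemma isClosed_outside (F : Finset {q : (T₁ × T₂) × (T₁ × T₂) // Disjoint E (quad q)}) :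
    IsClosed (outside F) := by
  have : outside F = ⋂ q ∈ F, (quad q.1)ᶜ := by
    ext z
    simp [outside]
  rw [this]
  refine isClosed_biInter fun q _ => IsOpen.isClosed_compl ?_
  exact (by simpa using (isClosed_compl_dirAt q.1.1.1 q.1.2.1).isOpen_compl : IsOpen _).prod
    (by simpa using (isClosed_compl_dirAt q.1.1.2 q.1.2.2).isOpen_compl : IsOpen _)

open Classical in
lemma nonempty_model (hT₁ : IsRTree T₁) (hT₂ : IsRTree T₂) (hE : IsQuadComplement E)
    (F : Finset {q : (T₁ × T₂) × (T₁ × T₂) // Disjoint E (quad q)}) :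
    Nonempty (Model (outside F)) := by
  induction F using Finset.induction_on with
  | empty =>
    refine ⟨⟨WithLp 2 (T₁ × T₂), _, isModel_ofLp hT₁ hT₂, ?_⟩⟩
    ext z
    exact ⟨fun _ q hq => absurd hq (Finset.notMem_empty q), fun _ => ⟨toL z, rfl⟩⟩
  | insert q F _ ih =>
    obtain ⟨m⟩ := ih
    have hins : outside (insert q F) = outside F \ quad q.1 := by
      ext z
      simp [outside, and_comm]
    rcases (outside F ∩ quad q.1).eq_empty_or_nonempty with h0 | ⟨z₀, hz₀, hz₀q⟩
    · rw [hins, sdiff_eq_left.2 (disjoint_iff_inter_eq_empty.2 h0)]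
      exact ⟨m⟩
    obtain ⟨⟨⟨a, b⟩, α, β⟩, hq⟩ := q
    have hk : ∀ x y : m.carrier, (m.map x).2 ∈ dirAt b β → (m.map y).1 ∈ dirAt a α →
        x ∈ fstSide m.map a α → y ∈ sndSide m.map b β → ∃ k, m.map k = (a, b) := by
      intro x y hx2 hy1 hx1 hy2
      by_cases hab : (a, b) ∈ outside F
      · exact m.exists_map_eq hab
      exfalso
      simp only [outside, mem_ofPred_eq, not_forall, not_not] at hab
      obtain ⟨⟨⟨⟨a', b'⟩, α', β'⟩, hq'⟩, hF, ha, hb⟩ := hab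
      have hx := m.map_mem x _ hF
      have hy := m.map_mem y _ hF
      by_cases ha' : a' ∈ dirAt a α <;> by_cases hb' : b' ∈ dirAt b β
      · obtain ⟨z, hz, hz1, hz2⟩ := hE.exists_mem _ ⟨z₀, hz₀q⟩ hq
        exact disjoint_left.1 hq' hz
          ⟨hT₁.compl_dirAt_subset ha ha' hz1, hT₂.compl_dirAt_subset hb hb' hz2⟩
      · exact hx ⟨hT₁.compl_dirAt_subset ha ha' hx1, hT₂.dirAt_subset hb hb' hx2⟩
      · exact hy ⟨hT₁.dirAt_subset ha ha' hy1, hT₂.compl_dirAt_subset hb hb' hy2⟩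
      · exact hz₀ _ hF ⟨hT₁.dirAt_subset ha ha' hz₀q.1, hT₂.dirAt_subset hb hb' hz₀q.2⟩
    have hl := m.good.toIsCNModel.linked hT₁ hT₂ hk
    refine ⟨@Model.mk _ _ _ _ _ (Pruned (fstSide m.map a α) (sndSide m.map b β)) hl.metricSpace
      (fun x => m.map x.1) (m.good.pruned hT₁ hT₂ hk hl) ?_⟩
    rw [hins]
    ext z
    constructor
    · rintro ⟨x, rfl⟩
      exact ⟨m.map_mem _, fun hz => x.2.elim (fun h => h hz.1) fun h => h hz.2⟩
    · rintro ⟨hz, hzq⟩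
      obtain ⟨x, rfl⟩ := m.exists_map_eq hz
      exact ⟨⟨x, not_and_or.1 hzq⟩, rfl⟩

lemma IsQuadComplement.nonempty_model (hT₁ : IsRTree T₁) (hT₂ : IsRTree T₂)
    (hE : IsQuadComplement E) : Nonempty (Model E) := by
  classical
  let m := fun F => (Guirardel.nonempty_model hT₁ hT₂ hE F).some
  refine ⟨@Model.mk _ _ _ _ _ (LimitSpace (outside (E := E))) (limitMetricSpace m)
    LimitSpace.val (isModel_limit m hT₁ hT₂ antitone_outside isClosed_outside) ?_⟩
  ext z
  constructor
  · rintro ⟨x, rfl⟩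
    by_contra hx
    obtain ⟨q, hq, hqE⟩ := hE.exists_quad _ hx
    exact x.mem {⟨q, hqE⟩} ⟨q, hqE⟩ (Finset.mem_singleton_self _) hq
  · exact fun hz => ⟨⟨z, fun F => subset_outside F hz⟩, rfl⟩

end Complements

/-! ### The induced path metric -/

section PathMetric

universe u v

variable {T₁ : Type u} {T₂ : Type v} [MetricSpace T₁] [MetricSpace T₂]

lemma eVariationOn_le_pathLen2 (c : ℝ → T₁ × T₂) :
    eVariationOn (fun s => toL (c s)) (Icc 0 1) ≤ pathLen2 c := by
  refine iSup_le fun ⟨n, s, hs, hs'⟩ => ?_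
  refine le_trans (le_of_eq ?_) (le_iSup_of_le n <| le_iSup_of_le (fun i => s i) <|
    le_iSup_of_le (fun i j hij => hs hij) <| le_iSup_of_le (fun i => hs' i) le_rfl)
  rw [Finset.sum_range]
  refine Finset.sum_congr rfl fun i _ => ?_
  rw [edist_comm, edist_toL]
  simp

lemma pathLen2_le {c : ℝ → T₁ × T₂} {D : ℝ} (hD : 0 ≤ D)
    (hc : ∀ s ∈ Icc (0 : ℝ) 1, ∀ t ∈ Icc (0 : ℝ) 1, dist2 (c s) (c t) ≤ D * |s - t|) :
    pathLen2 c ≤ ENNReal.ofReal D := by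
  have tel : ∀ (n : ℕ) (u : Fin (n + 1) → ℝ),
      ∑ i : Fin n, (u i.succ - u i.castSucc) = u (Fin.last n) - u 0 := by
    intro n
    induction n with
    | zero => simp
    | succ n ih =>
      intro u
      have := ih fun i => u i.castSucc
      rw [Fin.sum_univ_castSucc]
      simp only [Fin.succ_castSucc] at this ⊢
      rw [this]
      simp
  refine iSup_le fun n => iSup_le fun u => iSup_le fun hu => iSup_le fun hu' => ?_
  have hmono : ∀ i : Fin n, u i.castSucc ≤ u i.succ := fun i => hu (Fin.castSucc_lt_succ).le
  calc ∑ i : Fin n, ENNReal.ofReal (dist2 (c (u i.castSucc)) (c (u i.succ)))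
      ≤ ∑ i : Fin n, ENNReal.ofReal (D * (u i.succ - u i.castSucc)) := by
        refine Finset.sum_le_sum fun i _ =>
          ENNReal.ofReal_le_ofReal ((hc _ (hu' _) _ (hu' _)).trans_eq ?_)
        rw [abs_sub_comm, abs_of_nonneg (sub_nonneg.2 (hmono i))]
    _ = ENNReal.ofReal (D * (u (Fin.last n) - u 0)) := by
        rw [← tel, Finset.mul_sum, ENNReal.ofReal_sum_of_nonneg]
        exact fun i _ => mul_nonneg hD (sub_nonneg.2 (hmono i))
    _ ≤ ENNReal.ofReal D := ENNReal.ofReal_le_ofReal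
        (mul_le_of_le_one_right hD (by linarith [(hu' (Fin.last n)).2, (hu' 0).1]))

lemma Model.pathDistOn_eq {E : Set (T₁ × T₂)} (m : Model E) (x y : E) :
    pathDistOn E x y = dist (m.lift x x.2) (m.lift y y.2) := by
  obtain ⟨D, hD⟩ : ∃ D, D = dist (m.lift x x.2) (m.lift y y.2) := ⟨_, rfl⟩
  have hD0 : 0 ≤ D := hD ▸ dist_nonneg
  rw [← hD]
  have : ∀ r : ℝ≥0∞, r = ENNReal.ofReal D → r.toReal = D := by
    rintro _ rfl
    exact ENNReal.toReal_ofReal hD0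
  refine this _ (le_antisymm ?_ ?_)
  · obtain ⟨f, hf0, hfD, hf⟩ := m.good.exists_geodesic (m.lift x x.2) (m.lift y y.2)
    rw [← hD] at hfD hf
    have hmem : ∀ s ∈ Icc (0 : ℝ) 1, D * s ∈ Icc 0 D := fun s hs =>
      ⟨mul_nonneg hD0 hs.1, mul_le_of_le_one_right hD0 hs.2⟩
    have hc : ContinuousOn (fun s => m.map (f (D * s))) (Icc 0 1) :=
      m.good.continuous.comp_continuousOn
        ((continuousOn_of_dist_eq hf).comp (by fun_prop) hmem)
    refine iInf_le_of_le (fun s => m.map (f (D * s))) <| iInf_le_of_le hc <|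
      iInf_le_of_le (fun s _ => m.map_mem _) <| iInf_le_of_le (by simp [hf0]) <|
      iInf_le_of_le (by simp [hfD]) <| pathLen2_le hD0 fun s hs t ht => ?_
    refine (m.good.lower _ _).trans_eq ?_
    rw [hf _ (hmem s hs) _ (hmem t ht), ← mul_sub, abs_mul, abs_of_nonneg hD0]
  · refine le_iInf fun c => le_iInf fun hc => le_iInf fun hcE => le_iInf fun h0 =>
      le_iInf fun h1 => ?_
    have : ∀ s, ∃ k : m.carrier, s ∈ Icc (0 : ℝ) 1 → m.map k = c s := by
      intro s
      by_cases hs : s ∈ Icc (0 : ℝ) 1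
      · exact ⟨m.lift _ (hcE hs), fun _ => m.map_lift _ _⟩
      · exact ⟨m.lift x x.2, fun h => absurd h hs⟩
    choose k hk using this
    have hkc : ContinuousOn k (Icc 0 1) := by
      intro s hs
      rw [ContinuousWithinAt, tendsto_iff_dist_tendsto_zero]
      have e1 := (continuous_fst.comp_continuousOn hc s hs).dist
        (tendsto_const_nhds (x := (c s).1))
      have e2 := (continuous_snd.comp_continuousOn hc s hs).dist
        (tendsto_const_nhds (x := (c s).2))
      have e := e1.add e2
      simp only [comp_apply, dist_self, add_zero] at e
      refine squeeze_zero' (Eventually.of_forall fun _ => dist_nonneg) ?_ e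
      filter_upwards [self_mem_nhdsWithin] with t ht
      have := m.good.upper (k t) (k s)
      rwa [hk t ht, hk s hs] at this
    have key := m.good.path k 0 1 zero_le_one hkc
    have e0 : k 0 = m.lift x x.2 := m.good.injective (by simp [hk, h0])
    have e1 : k 1 = m.lift y y.2 := m.good.injective (by simp [hk, h1])
    rw [e0, e1, edist_dist, ← hD] at key
    refine key.trans (le_trans (le_of_eq ?_) (eVariationOn_le_pathLen2 c))
    exact eVariationOn.eq_of_eqOn fun s hs => by rw [hk s hs]

lemma Model.isCAT0Dist {E : Set (T₁ × T₂)} (m : Model E) : IsCAT0Dist (pathDistOn E) where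
  refl x := by rw [m.pathDistOn_eq, dist_self]
  symm x y := by rw [m.pathDistOn_eq, m.pathDistOn_eq, dist_comm]
  triangle x y z := by simpa only [m.pathDistOn_eq] using dist_triangle _ _ _
  eq_of_dist_eq_zero x y h := by
    rw [m.pathDistOn_eq, dist_eq_zero] at h
    exact Subtype.ext (by rw [← m.map_lift x x.2, h, m.map_lift])
  geodesic x y := by
    obtain ⟨f, hf0, hfD, hf⟩ := m.good.exists_geodesic (m.lift x x.2) (m.lift y y.2)
    have hl : ∀ k (hk : m.map k ∈ E), m.lift (m.map k) hk = k := fun k hk =>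
      m.good.injective (m.map_lift _ _)
    refine ⟨fun s => ⟨m.map (f s), m.map_mem _⟩, ?_, ?_, fun s hs t ht => ?_⟩
    · exact Subtype.ext (by simp [hf0])
    · exact Subtype.ext (by simp [m.pathDistOn_eq, hfD])
    · rw [m.pathDistOn_eq] at hs ht ⊢
      rw [hl, hl]
      exact hf s hs t ht
  cn x y z w h1 h2 := by
    simp only [m.pathDistOn_eq] at *
    have ht : (1 / 2 : ℝ) ∈ Icc (0 : ℝ) 1 := by norm_num
    obtain ⟨v, -, hv⟩ := m.good.cn (m.lift y y.2) (mem_univ _) (m.lift z z.2) (mem_univ _) _ ht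
    have e : m.lift w w.2 = v :=
      (hv _ (mem_univ _)).eq_of_dist_le ht (by rw [h1]; linarith) (by rw [h2]; linarith)
    have := hv (m.lift x x.2) (mem_univ _)
    rw [← e] at this
    unfold CNAt at this
    linarith

end PathMetric

/-! ### Diagonals between the corners of twice-light rectangles -/

section Diagonals

universe u v

/-- The set `C` is a complement of quadrants, and its projections meet all the directions. -/
structure IsCoreLike {T₁ : Type u} {T₂ : Type v} [MetricSpace T₁] [MetricSpace T₂]
    (C : Set (T₁ × T₂)) : Prop where
  exists_quad : ∀ z ∉ C, ∃ q, z ∈ quad q ∧ Disjoint C (quad q)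
  exists_fst : ∀ a y, y ≠ a → ∃ c ∈ C, c.1 ∈ dirAt a y
  exists_snd : ∀ b y, y ≠ b → ∃ c ∈ C, c.2 ∈ dirAt b y

/-- `p` and `q` are the opposite corners, lying in `C`, of a twice-light rectangle. -/
structure IsDiag {T₁ : Type u} {T₂ : Type v} [MetricSpace T₁] [MetricSpace T₂]
    (C : Set (T₁ × T₂)) (p q : T₁ × T₂) : Prop where
  left : p ∈ C
  right : q ∈ C
  fst_ne : p.1 ≠ q.1
  snd_ne : p.2 ≠ q.2
  disj : Disjoint C (dirAt p.1 q.1 ×ˢ dirAt q.2 p.2)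
  disj' : Disjoint C (dirAt q.1 p.1 ×ˢ dirAt p.2 q.2)

/-- The union of `C` and of its diagonals. -/
def withDiags {T₁ : Type u} {T₂ : Type v} [MetricSpace T₁] [MetricSpace T₂]
    (C : Set (T₁ × T₂)) : Set (T₁ × T₂) :=
  C ∪ {z | ∃ p q, IsDiag C p q ∧ z ∈ mainDiag p q}

/-- The set `C` with the two coordinates exchanged. -/
def swapped {T₁ : Type u} {T₂ : Type v} (C : Set (T₁ × T₂)) : Set (T₂ × T₁) := {z | z.swap ∈ C}

lemma disjoint_swapped {T₁ : Type u} {T₂ : Type v} {C : Set (T₁ × T₂)} {s : Set T₁} {t : Set T₂}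
    (h : Disjoint C (s ×ˢ t)) :
    Disjoint (swapped C) (t ×ˢ s) :=
  disjoint_left.2 fun _ hz hz' => disjoint_left.1 h hz ⟨hz'.2, hz'.1⟩

variable {T₁ : Type u} {T₂ : Type v} [MetricSpace T₁] [MetricSpace T₂]
variable {C : Set (T₁ × T₂)} {p q p' q' z u : T₁ × T₂}

lemma IsDiag.symm (h : IsDiag C p q) : IsDiag C q p :=
  ⟨h.right, h.left, h.fst_ne.symm, h.snd_ne.symm, h.disj', h.disj⟩

lemma mainDiag_symm (hz : z ∈ mainDiag p q) : z ∈ mainDiag q p := by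
  obtain ⟨h1, h2, h3⟩ := hz
  refine ⟨by rwa [seg_symm], by rwa [seg_symm], ?_⟩
  rw [mem_seg] at h1 h2
  rw [dist_comm q.1, dist_comm q.2, dist_comm q.2, dist_comm q.1, ← h1, ← h2]
  rw [← h1, ← h2] at h3
  linarith

lemma IsDiag.swapped (h : IsDiag C p q) : IsDiag (swapped C) p.swap q.swap :=
  ⟨h.left, h.right, h.snd_ne, h.fst_ne, disjoint_swapped h.disj', disjoint_swapped h.disj⟩

lemma IsCoreLike.swapped (hC : IsCoreLike C) : IsCoreLike (swapped C) where
  exists_quad z hz := by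
    obtain ⟨q, hq, hq'⟩ := hC.exists_quad z.swap hz
    exact ⟨(q.1.swap, q.2.swap), ⟨hq.2, hq.1⟩, disjoint_swapped hq'⟩
  exists_fst a y hy := by
    obtain ⟨c, hc, h⟩ := hC.exists_snd a y hy
    exact ⟨c.swap, hc, h⟩
  exists_snd a y hy := by
    obtain ⟨c, hc, h⟩ := hC.exists_fst a y hy
    exact ⟨c.swap, hc, h⟩

lemma mem_dirAt_or {T : Type*} [MetricSpace T] {x y : T} (h : x ≠ y) (e : T) :
    e ∈ dirAt x y ∨ e ∈ dirAt y x := by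
  by_contra! h'
  simp only [mem_dirAt, not_not] at h'
  exact h (eq_of_mem_seg_of_mem_seg h'.1 h'.2)

lemma IsDiag.fst_notMem (h : IsDiag C p q) {c : T₁ × T₂} (hc : c ∈ C) :
    ¬ (c.1 ∈ dirAt p.1 q.1 ∧ c.1 ∈ dirAt q.1 p.1) := fun h1 =>
  (mem_dirAt_or h.snd_ne c.2).elim (fun h2 => disjoint_left.1 h.disj' hc ⟨h1.2, h2⟩)
    fun h2 => disjoint_left.1 h.disj hc ⟨h1.1, h2⟩

/-- A direction between two points is not branching. -/
lemma IsDiag.fst_eq (hT₁ : IsRTree T₁) (hC : IsCoreLike C) (h : IsDiag C p q) {e w : T₁}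
    (hw : w ∈ seg p.1 q.1) (hwp : w ≠ p.1) (hwq : w ≠ q.1)
    (he : gprod p.1 q.1 e = dist p.1 w) : e = w := by
  by_contra hne
  obtain ⟨c, hc, hce⟩ := hC.exists_fst w e hne
  have h1 : c.1 ∉ dirAt w q.1 := fun hcq => by
    have := hT₁.mem_dirAt_trans (mem_dirAt_comm.1 hce) hcq
    rw [hT₁.mem_dirAt_iff_lt_gprod hw, he] at this
    exact lt_irrefl _ this
  have h2 : c.1 ∉ dirAt w p.1 := fun hcq => by
    have := hT₁.mem_dirAt_trans (mem_dirAt_comm.1 hce) hcq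
    rw [hT₁.mem_dirAt_iff_gprod_lt hw, he] at this
    exact lt_irrefl _ this
  rw [hT₁.mem_dirAt_iff_lt_gprod hw, not_lt] at h1
  rw [hT₁.mem_dirAt_iff_gprod_lt hw, not_lt] at h2
  refine h.fst_notMem hc ⟨?_, ?_⟩
  · rw [hT₁.mem_dirAt_iff_lt_gprod (left_mem_seg _ _), dist_self]
    exact (dist_pos.2 hwp.symm).trans_le h2
  · rw [hT₁.mem_dirAt_iff_gprod_lt (right_mem_seg _ _)]
    refine h1.trans_lt ?_
    rw [mem_seg] at hw
    linarith [dist_pos.2 hwq]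

/-- The diagonal from `p` to `q` crosses the quadrant `δ₁ × δ₂`, with `q` on the side of `δ₁`. -/
structure Crosses (δ₁ : Set T₁) (δ₂ : Set T₂) (p q : T₁ × T₂) : Prop where
  p_fst : p.1 ∉ δ₁
  q_fst : q.1 ∈ δ₁
  p_snd : p.2 ∈ δ₂
  q_snd : q.2 ∉ δ₂

lemma crosses_or {a α : T₁} {b β : T₂} (hT₁ : IsRTree T₁) (hT₂ : IsRTree T₂) (h : IsDiag C p q)
    (hQ : Disjoint C (dirAt a α ×ˢ dirAt b β)) (hz : z ∈ mainDiag p q)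
    (hz' : z ∈ dirAt a α ×ˢ dirAt b β) :
    Crosses (dirAt a α) (dirAt b β) p q ∨ Crosses (dirAt a α) (dirAt b β) q p := by
  have h1 : p.1 ∈ dirAt a α ∨ q.1 ∈ dirAt a α := by
    by_contra! h'
    exact hT₁.treeConvex_compl_dirAt a α _ h'.1 _ h'.2 hz.1 hz'.1
  have h2 : p.2 ∈ dirAt b β ∨ q.2 ∈ dirAt b β := by
    by_contra! h'
    exact hT₂.treeConvex_compl_dirAt b β _ h'.1 _ h'.2 hz.2.1 hz'.2
  have h3 := disjoint_left.1 hQ h.left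
  have h4 := disjoint_left.1 hQ h.right
  rw [mem_prod] at h3 h4
  by_cases hp : p.1 ∈ dirAt a α
  · exact Or.inr ⟨by tauto, hp, by tauto, by tauto⟩
  · exact Or.inl ⟨hp, by tauto, by tauto, by tauto⟩

lemma IsRTree.dirAt_subset_of_mem {T : Type*} [MetricSpace T] (hT : IsRTree T) {a α x y : T}
    (hx : x ∉ dirAt a α) (hy : y ∈ dirAt a α) : dirAt a α ⊆ dirAt x y := by
  intro e he
  have ha : a ∈ seg x y := by
    rw [seg_symm]
    exact hT.mem_seg_of_mem_dirAt hy hx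
  rw [← hT.dirAt_eq hy, hT.mem_dirAt_iff_lt_gprod ha] at he
  rw [hT.mem_dirAt_iff_lt_gprod (left_mem_seg _ _), dist_self]
  exact dist_nonneg.trans_lt he

lemma Crosses.eq {a α : T₁} {b β : T₂} (hT₁ : IsRTree T₁) (hT₂ : IsRTree T₂)
    (h : IsDiag C p q) (h' : IsDiag C p' q') (hc : Crosses (dirAt a α) (dirAt b β) p q)
    (hc' : Crosses (dirAt a α) (dirAt b β) p' q') : p = p' ∧ q = q' := by
  have key1 : ∀ {p q p' q' : T₁ × T₂}, IsDiag C p q → IsDiag C p' q' →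
      Crosses (dirAt a α) (dirAt b β) p q → Crosses (dirAt a α) (dirAt b β) p' q' →
      p.1 ∈ seg q.1 p'.1 ∧ q.2 ∈ seg p.2 q'.2 := by
    intro p q p' q' h h' hc hc'
    have s1 := hT₁.dirAt_subset_of_mem hc.p_fst hc.q_fst
    have s2 := hT₂.dirAt_subset_of_mem hc.q_snd hc.p_snd
    constructor
    · exact hT₁.mem_seg_of_mem_dirAt (s1 hc.q_fst)
        fun k => disjoint_left.1 h.disj h'.left ⟨k, s2 hc'.p_snd⟩
    · exact hT₂.mem_seg_of_mem_dirAt (s2 hc.p_snd)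
        fun k => disjoint_left.1 h.disj h'.right ⟨s1 hc'.q_fst, k⟩
  obtain ⟨i1, i2⟩ := key1 h h' hc hc'
  obtain ⟨j1, j2⟩ := key1 h' h hc' hc
  have j1' : p'.1 ∈ seg q.1 p.1 := by
    have s1 := hT₁.dirAt_subset_of_mem hc'.p_fst hc'.q_fst
    have s2 := hT₂.dirAt_subset_of_mem hc'.q_snd hc'.p_snd
    exact hT₁.mem_seg_of_mem_dirAt (s1 hc.q_fst)
        fun k => disjoint_left.1 h'.disj h.left ⟨k, s2 hc.p_snd⟩
  have j2' : q'.2 ∈ seg p.2 q.2 := by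
    have s1 := hT₁.dirAt_subset_of_mem hc'.p_fst hc'.q_fst
    have s2 := hT₂.dirAt_subset_of_mem hc'.q_snd hc'.p_snd
    exact hT₂.mem_seg_of_mem_dirAt (s2 hc.p_snd)
        fun k => disjoint_left.1 h'.disj h.right ⟨s1 hc.q_fst, k⟩
  have e1 : p.1 = p'.1 := eq_of_mem_seg_of_mem_seg i1 j1'
  have e2 : q.2 = q'.2 := eq_of_mem_seg_of_mem_seg i2 j2'
  have key2 : ∀ {p q p' q' : T₁ × T₂}, IsDiag C p q → IsDiag C p' q' → p.1 = p'.1 →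
      q.2 = q'.2 → q.1 ∈ seg p.1 q'.1 ∧ p.2 ∈ seg q.2 p'.2 := by
    intro p q p' q' h h' e1 e2
    constructor
    · exact hT₁.mem_seg_of_mem_dirAt (self_mem_dirAt h.fst_ne) fun k =>
        disjoint_left.1 h.disj' h'.right ⟨k, e2 ▸ self_mem_dirAt h.snd_ne.symm⟩
    · exact hT₂.mem_seg_of_mem_dirAt (self_mem_dirAt h.snd_ne.symm) fun k =>
        disjoint_left.1 h.disj' h'.left ⟨e1 ▸ self_mem_dirAt h.fst_ne, k⟩
  obtain ⟨k1, k2⟩ := key2 h h' e1 e2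
  obtain ⟨l1, l2⟩ := key2 h' h e1.symm e2.symm
  rw [← e1] at l1
  rw [← e2] at l2
  exact ⟨Prod.ext e1 (eq_of_mem_seg_of_mem_seg k2 l2), Prod.ext (eq_of_mem_seg_of_mem_seg k1 l1) e2⟩

/-- The quadrant above a point of a diagonal is disjoint from `C` and all the diagonals. -/
lemma IsDiag.disjoint_quad (hT₁ : IsRTree T₁) (hT₂ : IsRTree T₂) (h : IsDiag C p q)
    (hu : u ∈ mainDiag p q) (hu1 : u.1 ≠ q.1) (hu2 : u.2 ≠ p.2) :
    Disjoint (withDiags C) (dirAt u.1 q.1 ×ˢ dirAt u.2 p.2) := by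
  have hcr : Crosses (dirAt u.1 q.1) (dirAt u.2 p.2) p q :=
    ⟨fun k => k hu.1, self_mem_dirAt hu1.symm, self_mem_dirAt hu2.symm,
      fun k => k (by rw [seg_symm]; exact hu.2.1)⟩
  have hdC : Disjoint C (dirAt u.1 q.1 ×ˢ dirAt u.2 p.2) :=
    h.disj.mono_right (prod_mono (hT₁.dirAt_subset_of_mem hcr.p_fst hcr.q_fst)
      (hT₂.dirAt_subset_of_mem hcr.q_snd hcr.p_snd))
  have hself : ∀ z ∈ mainDiag p q, z ∉ dirAt u.1 q.1 ×ˢ dirAt u.2 p.2 := by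
    rintro z hz ⟨hz1, hz2⟩
    rw [hT₁.mem_dirAt_iff_lt_gprod hu.1, gprod_of_mem_seg hz.1] at hz1
    have := hu.2.1
    rw [seg_symm] at this
    rw [hT₂.mem_dirAt_iff_lt_gprod this, gprod_of_mem_seg (by rw [seg_symm]; exact hz.2.1)] at hz2
    have e1 := mem_seg.1 hz.2.1
    have e2 := mem_seg.1 hu.2.1
    rw [dist_comm q.2, dist_comm q.2] at hz2
    have k1 := mul_lt_mul_of_pos_right hz1 (dist_pos.2 h.snd_ne)
    have k2 : dist p.2 z.2 * dist p.1 q.1 < dist p.2 u.2 * dist p.1 q.1 :=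
      mul_lt_mul_of_pos_right (by linarith) (dist_pos.2 h.fst_ne)
    linarith [hz.2.2, hu.2.2]
  refine disjoint_left.2 ?_
  rintro z (hz | ⟨p', q', h', hz⟩) hzQ
  · exact disjoint_left.1 hdC hz hzQ
  rcases crosses_or hT₁ hT₂ h' hdC hz hzQ with hcr' | hcr'
  · obtain ⟨rfl, rfl⟩ := hcr.eq hT₁ hT₂ h h' hcr'
    exact hself z hz hzQ
  · obtain ⟨rfl, rfl⟩ := hcr.eq hT₁ hT₂ h h'.symm hcr'
    exact hself z (mainDiag_symm hz) hzQ

lemma exists_mem_mainDiag (hT₁ : IsRTree T₁) (hT₂ : IsRTree T₂) (p q : T₁ × T₂) {τ : ℝ}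
    (hτ : τ ∈ Icc (0 : ℝ) 1) : ∃ u ∈ mainDiag p q, dist p.1 u.1 = τ * dist p.1 q.1 ∧
      dist q.2 u.2 = (1 - τ) * dist q.2 p.2 := by
  obtain ⟨u₁, h1, e1, -⟩ := hT₁.exists_mem_seg p.1 q.1 (mul_nonneg hτ.1 dist_nonneg)
    (mul_le_of_le_one_left dist_nonneg hτ.2)
  obtain ⟨u₂, h2, e2, e2'⟩ := hT₂.exists_mem_seg p.2 q.2 (mul_nonneg hτ.1 dist_nonneg)
    (mul_le_of_le_one_left dist_nonneg hτ.2)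
  refine ⟨(u₁, u₂), ⟨h1, h2, ?_⟩, e1, ?_⟩
  · rw [e1, e2]; ring
  · rw [dist_comm q.2, e2', dist_comm q.2]; ring

lemma IsCoreLike.exists_quad_withDiags (hT₁ : IsRTree T₁) (hT₂ : IsRTree T₂)
    (hC : IsCoreLike C) (hz : z ∉ withDiags C) :
    ∃ q, z ∈ quad q ∧ Disjoint (withDiags C) (quad q) := by
  obtain ⟨⟨⟨a, b⟩, α, β⟩, hzQ, hQ⟩ := hC.exists_quad z fun h => hz (Or.inl h)
  by_cases hd : Disjoint (withDiags C) (quad ((a, b), (α, β)))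
  · exact ⟨_, hzQ, hd⟩
  obtain ⟨w, hw | ⟨p, q, h, hwd⟩, hwQ⟩ := not_disjoint_iff.1 hd
  · exact absurd hwQ (disjoint_left.1 hQ hw)
  wlog hcr : Crosses (dirAt a α) (dirAt b β) p q generalizing p q
  · exact this q p h.symm (mainDiag_symm hwd)
      ((crosses_or hT₁ hT₂ h hQ hwd hwQ).resolve_left hcr)
  have hL1 := dist_pos.2 h.fst_ne
  have hL2 := dist_pos.2 h.snd_ne.symm
  have hz1 := hT₁.dirAt_subset_of_mem hcr.p_fst hcr.q_fst hzQ.1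
  have hz2 := hT₂.dirAt_subset_of_mem hcr.q_snd hcr.p_snd hzQ.2
  rw [hT₁.mem_dirAt_iff_lt_gprod (left_mem_seg _ _), dist_self] at hz1
  rw [hT₂.mem_dirAt_iff_lt_gprod (left_mem_seg _ _), dist_self] at hz2
  obtain ⟨σ, hσ⟩ : ∃ σ, gprod p.1 q.1 z.1 = σ * dist p.1 q.1 :=
    ⟨_, (div_mul_cancel₀ _ hL1.ne').symm⟩
  obtain ⟨ρ, hρ⟩ : ∃ ρ, gprod q.2 p.2 z.2 = ρ * dist q.2 p.2 :=
    ⟨_, (div_mul_cancel₀ _ hL2.ne').symm⟩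
  have hσ1 := gprod_le p.1 q.1 z.1
  have hρ1 := gprod_le q.2 p.2 z.2
  rw [hσ] at hσ1 hz1
  rw [hρ] at hρ1 hz2
  have hσ0 : 0 < σ := pos_of_mul_pos_left hz1 hL1.le
  have hρ0 : 0 < ρ := pos_of_mul_pos_left hz2 hL2.le
  replace hσ1 : σ ≤ 1 := by by_contra! hcon; nlinarith
  replace hρ1 : ρ ≤ 1 := by by_contra! hcon; nlinarith
  have main : ∀ τ, 0 < τ → τ < 1 → ∃ u ∈ mainDiag p q, dist p.1 u.1 = τ * dist p.1 q.1 ∧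
      dist q.2 u.2 = (1 - τ) * dist q.2 p.2 ∧ u.1 ≠ q.1 ∧ u.2 ≠ p.2 ∧ u.1 ≠ p.1 ∧ u.2 ≠ q.2 := by
    intro τ h0 h1
    obtain ⟨u, hu, e1, e2⟩ := exists_mem_mainDiag hT₁ hT₂ p q ⟨h0.le, h1.le⟩
    refine ⟨u, hu, e1, e2, fun k => ?_, fun k => ?_, fun k => ?_, fun k => ?_⟩
    · rw [k] at e1; nlinarith
    · rw [k] at e2; nlinarith
    · rw [k, dist_self] at e1; nlinarith
    · rw [k, dist_self] at e2; nlinarith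
  rcases lt_trichotomy (σ + ρ) 1 with hlt | heq | hgt
  · obtain ⟨u, hu, e1, e2, -, -, n1, n2⟩ := main ((σ + (1 - ρ)) / 2) (by linarith) (by linarith)
    have hd' := h.symm.disjoint_quad hT₁ hT₂ (mainDiag_symm hu) n1 n2
    refine ⟨(u, (p.1, q.2)), ⟨?_, ?_⟩, hd'⟩
    · rw [hT₁.mem_dirAt_iff_gprod_lt hu.1, hσ, e1]
      exact mul_lt_mul_of_pos_right (by linarith) hL1
    · rw [hT₂.mem_dirAt_iff_gprod_lt (mainDiag_symm hu).2.1, hρ, e2]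
      exact mul_lt_mul_of_pos_right (by linarith) hL2
  · obtain ⟨u, hu, e1, e2, n1, n2, n3, n4⟩ := main σ hσ0 (by linarith)
    refine absurd (Or.inr ⟨p, q, h, ?_⟩) hz
    have k1 : z.1 = u.1 := h.fst_eq hT₁ hC hu.1 n3 n1 (by rw [hσ, e1])
    have k2 : z.2 = u.2 := h.symm.swapped.fst_eq hT₂ hC.swapped (mainDiag_symm hu).2.1 n4 n2
      (by
        have : 1 - σ = ρ := by linarith
        change gprod q.2 p.2 z.2 = dist q.2 u.2
        rw [hρ, e2, this])
    rwa [show z = u from Prod.ext k1 k2]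
  · obtain ⟨u, hu, e1, e2, n1, n2, -, -⟩ := main ((σ + (1 - ρ)) / 2) (by linarith) (by linarith)
    have hd' := h.disjoint_quad hT₁ hT₂ hu n1 n2
    refine ⟨(u, (q.1, p.2)), ⟨?_, ?_⟩, hd'⟩
    · rw [hT₁.mem_dirAt_iff_lt_gprod hu.1, hσ, e1]
      exact mul_lt_mul_of_pos_right (by linarith) hL1
    · rw [hT₂.mem_dirAt_iff_lt_gprod (mainDiag_symm hu).2.1, hρ, e2]
      exact mul_lt_mul_of_pos_right (by linarith) hL2

/-- The upper left corner of a subset of `C` belongs to `C`. -/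
lemma IsCoreLike.corner_mem (hT₁ : IsRTree T₁) (hT₂ : IsRTree T₂) (hC : IsCoreLike C)
    {c c' : T₁ × T₂} (hc : c ∈ C) (hc' : c' ∈ C) {S : Set (T₁ × T₂)} (hS : S ⊆ C)
    (hp1 : p.1 ∈ seg c'.1 c.1) (hp2 : p.2 ∈ seg c.2 c'.2)
    (h1 : IsLUB ((fun e => gprod c'.1 c.1 e.1) '' S) (dist c'.1 p.1))
    (h2 : IsGLB ((fun e => gprod c.2 c'.2 e.2) '' S) (dist c.2 p.2)) : p ∈ C := by
  by_contra hp
  obtain ⟨⟨⟨a, b⟩, α, β⟩, ⟨hpa, hpb⟩, hQ⟩ := hC.exists_quad p hp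
  have hQ' : ∀ e ∈ C, e.1 ∈ dirAt a α → e.2 ∉ dirAt b β :=
    fun e he k1 k2 => disjoint_left.1 hQ he ⟨k1, k2⟩
  have ub : ∀ e ∈ S, gprod c'.1 c.1 e.1 ≤ dist c'.1 p.1 := fun e he => h1.1 ⟨e, he, rfl⟩
  have lb : ∀ e ∈ S, dist c.2 p.2 ≤ gprod c.2 c'.2 e.2 := fun e he => h2.1 ⟨e, he, rfl⟩
  rcases hT₁.dirAt_trichotomy hp1 hpa with ⟨i1, i2⟩ | ⟨i1, i2, r, hr, hr'⟩ | ⟨i1, i2, r, hr, hr'⟩ <;>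
  rcases hT₂.dirAt_trichotomy hp2 hpb with ⟨j1, j2⟩ | ⟨j1, j2, t, ht, ht'⟩ | ⟨j1, j2, t, ht, ht'⟩
  · exact hQ' c hc i2 j1
  · exact hQ' c hc i2 j1
  · exact hQ' c' hc' i1 j1
  · exact hQ' c' hc' i1 j2
  · obtain ⟨_, ⟨e, he, rfl⟩, -, hlt⟩ := h2.exists_between ht
    refine hQ' e (hS he) ?_ ?_
    · rw [hr']; exact (ub e he).trans_lt hr
    · rw [ht']; exact hlt
  · exact hQ' c' hc' i1 j1
  · exact hQ' c hc i1 j1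
  · exact hQ' c hc i1 j1
  · obtain ⟨_, ⟨e, he, rfl⟩, hlt, -⟩ := h1.exists_between hr
    refine hQ' e (hS he) ?_ ?_
    · rw [hr']; exact hlt
    · rw [ht']; exact ht.trans_le (lb e he)

lemma IsRTree.dist_eq_sub {T : Type*} [MetricSpace T] (hT : IsRTree T) {c' c x y : T}
    (hx : x ∈ seg c' c) (hy : y ∈ seg c' c) (h : dist c' x ≤ dist c' y) :
    dist x y = dist c' y - dist c' x := by
  have h1 : y ∉ dirAt x c' := by
    rw [hT.mem_dirAt_iff_gprod_lt hx, gprod_of_mem_seg hy]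
    exact h.not_gt
  rw [mem_dirAt, not_not, mem_seg, dist_comm y x, dist_comm x c', dist_comm y c'] at h1
  linarith

lemma IsRTree.gprod_eq_add {T : Type*} [MetricSpace T] (hT : IsRTree T) {c' c x y z : T}
    (hx : x ∈ seg c' c) (hy : y ∈ seg c' c) (h : dist c' x ≤ dist c' y) (hz : z ∈ seg x y) :
    gprod c' c z = dist c' x + dist x z := by
  have h1 := hT.dist_eq_sub hx hy h
  rw [mem_seg] at hx hy hz
  have h2 := dist_triangle c' x z
  have h3 := dist_triangle z y c
  have h4 := dist_triangle c' z c
  unfold gprod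
  rw [dist_comm c' z] at *
  linarith

/-- The directions between two points of a segment, compared with those of its endpoints. -/
lemma IsRTree.dirAt_eq_of_lt {T : Type*} [MetricSpace T] (hT : IsRTree T) {c' c x y : T}
    (hx : x ∈ seg c' c) (hy : y ∈ seg c' c) (h : dist c' x < dist c' y) :
    dirAt x y = dirAt x c ∧ dirAt y x = dirAt y c' := by
  refine ⟨hT.dirAt_eq ?_, hT.dirAt_eq ?_⟩
  · rwa [hT.mem_dirAt_iff_lt_gprod hx, gprod_of_mem_seg hy]
  · rwa [hT.mem_dirAt_iff_gprod_lt hy, gprod_of_mem_seg hx]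

lemma exists_mem_iff {a b s s' r r' : ℝ} (hs : s ≤ a) (hs' : a < s') (hr : r ≤ b)
    (hr' : b < r') : ∃ τ ∈ Icc (0 : ℝ) 1,
      (a < s + τ * (s' - s) ↔ b < r + (1 - τ) * (r' - r)) := by
  have h1 : 0 < s' - s := by linarith
  have h2 : 0 < r' - r := by linarith
  obtain ⟨σ, hσ⟩ : ∃ σ, a - s = σ * (s' - s) := ⟨_, (div_mul_cancel₀ _ h1.ne').symm⟩
  obtain ⟨ρ, hρ⟩ : ∃ ρ, r' - b = ρ * (r' - r) := ⟨_, (div_mul_cancel₀ _ h2.ne').symm⟩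
  have hσ0 : 0 ≤ σ := by by_contra! h; nlinarith
  have hσ1 : σ < 1 := by by_contra! h; nlinarith
  have hρ0 : 0 < ρ := by by_contra! h; nlinarith
  have hρ1 : ρ ≤ 1 := by by_contra! h; nlinarith
  rcases le_or_gt ρ σ with h | h
  · refine ⟨σ, ⟨hσ0, hσ1.le⟩, iff_of_false ?_ ?_⟩ <;> rw [not_lt] <;> nlinarith
  · refine ⟨(σ + ρ) / 2, ⟨by linarith, by linarith⟩, iff_of_true ?_ ?_⟩ <;> nlinarith

lemma IsCoreLike.exists_mem_withDiags (hT₁ : IsRTree T₁) (hT₂ : IsRTree T₂) (hC : IsCoreLike C)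
    {a α : T₁} {b β : T₂} (hne : (dirAt a α ×ˢ dirAt b β).Nonempty)
    (hQ : Disjoint (withDiags C) (dirAt a α ×ˢ dirAt b β)) :
    ∃ z ∈ withDiags C, z.1 ∉ dirAt a α ∧ z.2 ∉ dirAt b β := by
  by_contra! hcon
  have hα : α ≠ a := by
    rintro rfl
    exact not_mem_dirAt_self _ _ (mem_dirAt_comm.1 hne.some_mem.1)
  have hβ : β ≠ b := by
    rintro rfl
    exact not_mem_dirAt_self _ _ (mem_dirAt_comm.1 hne.some_mem.2)
  have key : ∀ e ∈ withDiags C, ¬ (e.1 ∈ dirAt a α ↔ e.2 ∈ dirAt b β) := by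
    intro e he h
    by_cases h1 : e.1 ∈ dirAt a α
    · exact disjoint_left.1 hQ he ⟨h1, h.1 h1⟩
    · exact h1 (h.2 (hcon e he h1))
  obtain ⟨c, hc, hcδ⟩ := hC.exists_fst a α hα
  obtain ⟨c', hc', hcδ'⟩ := hC.exists_snd b β hβ
  have hcβ : c.2 ∉ dirAt b β := fun h => key c (Or.inl hc) (iff_of_true hcδ h)
  have hcα : c'.1 ∉ dirAt a α := fun h => key c' (Or.inl hc') (iff_of_true h hcδ')
  have ha : a ∈ seg c'.1 c.1 := by
    rw [seg_symm]
    exact hT₁.mem_seg_of_mem_dirAt hcδ hcα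
  have hb : b ∈ seg c.2 c'.2 := by
    rw [seg_symm]
    exact hT₂.mem_seg_of_mem_dirAt hcδ' hcβ
  have mem1 : ∀ e, e ∈ dirAt a α ↔ dist c'.1 a < gprod c'.1 c.1 e := fun e => by
    rw [← hT₁.dirAt_eq hcδ, hT₁.mem_dirAt_iff_lt_gprod ha]
  have mem2 : ∀ e, e ∈ dirAt b β ↔ dist c.2 b < gprod c.2 c'.2 e := fun e => by
    rw [← hT₂.dirAt_eq hcδ', hT₂.mem_dirAt_iff_lt_gprod hb]
  simp only [mem1, mem2] at key hcδ hcδ' hcβ hcα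
  clear hcon hQ hne hα hβ
  set φ : T₁ × T₂ → ℝ := fun e => gprod c'.1 c.1 e.1 with hφ
  set ψ : T₁ × T₂ → ℝ := fun e => gprod c.2 c'.2 e.2 with hψ
  set L : Set (T₁ × T₂) := {e ∈ C | φ e ≤ dist c'.1 a} with hL
  set R : Set (T₁ × T₂) := {e ∈ C | dist c'.1 a < φ e} with hR
  have hLψ : ∀ e ∈ L, dist c.2 b < ψ e := fun e he => by
    by_contra h
    exact key e (Or.inl he.1) (iff_of_false he.2.not_gt h)
  have hRψ : ∀ e ∈ R, ψ e ≤ dist c.2 b := fun e he => by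
    by_contra h
    exact key e (Or.inl he.1) (iff_of_true he.2 (not_le.1 h))
  have hcR : c ∈ R := ⟨hc, hcδ⟩
  have hcL : c' ∈ L := ⟨hc', not_lt.1 hcα⟩
  have hs : IsLUB (φ '' L) (sSup (φ '' L)) :=
    isLUB_csSup ⟨_, c', hcL, rfl⟩ ⟨_, forall_mem_image.2 fun e he => he.2⟩
  have hr' : IsGLB (ψ '' L) (sInf (ψ '' L)) :=
    isGLB_csInf ⟨_, c', hcL, rfl⟩ ⟨_, forall_mem_image.2 fun e he => (hLψ e he).le⟩
  have hs' : IsGLB (φ '' R) (sInf (φ '' R)) :=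
    isGLB_csInf ⟨_, c, hcR, rfl⟩ ⟨_, forall_mem_image.2 fun e he => he.2.le⟩
  have hr : IsLUB (ψ '' R) (sSup (ψ '' R)) :=
    isLUB_csSup ⟨_, c, hcR, rfl⟩ ⟨_, forall_mem_image.2 fun e he => hRψ e he⟩
  obtain ⟨p₁, hp1, ep1, -⟩ := hT₁.exists_mem_seg c'.1 c.1
    ((gprod_nonneg _ _ _).trans (hs.1 ⟨c', hcL, rfl⟩))
    (hs.2 (forall_mem_image.2 fun e _ => gprod_le _ _ _))
  obtain ⟨p₂, hp2, ep2, -⟩ := hT₂.exists_mem_seg c.2 c'.2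
    (hr'.2 (forall_mem_image.2 fun e _ => gprod_nonneg _ _ _))
    ((hr'.1 ⟨c', hcL, rfl⟩).trans (gprod_le _ _ _))
  obtain ⟨q₁, hq1, eq1, -⟩ := hT₁.exists_mem_seg c'.1 c.1
    (hs'.2 (forall_mem_image.2 fun e _ => gprod_nonneg _ _ _))
    ((hs'.1 ⟨c, hcR, rfl⟩).trans (gprod_le _ _ _))
  obtain ⟨q₂, hq2, eq2, -⟩ := hT₂.exists_mem_seg c.2 c'.2
    ((gprod_nonneg _ _ _).trans (hr.1 ⟨c, hcR, rfl⟩))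
    (hr.2 (forall_mem_image.2 fun e _ => gprod_le _ _ _))
  rw [← ep1] at hs
  rw [← ep2] at hr'
  rw [← eq1] at hs'
  rw [← eq2] at hr
  have hpC : (p₁, p₂) ∈ C :=
    hC.corner_mem hT₁ hT₂ hc hc' (fun e he => he.1) hp1 hp2 hs hr'
  have himg : ∀ f : T₁ × T₂ → ℝ, (fun e : T₂ × T₁ => f e.swap) '' Guirardel.swapped R = f '' R := fun f => by
    ext x
    exact ⟨fun ⟨e, he, h⟩ => ⟨e.swap, he, h⟩, fun ⟨e, he, h⟩ => ⟨e.swap, he, h⟩⟩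
  have hqC : (q₁, q₂) ∈ C := by
    refine hC.swapped.corner_mem hT₂ hT₁ (p := (q₂, q₁)) (c := c'.swap) (c' := c.swap) hc' hc
      (S := Guirardel.swapped R) (fun e he => he.1) hq2 hq1 ?_ ?_
    · rw [← himg] at hr
      exact hr
    · rw [← himg] at hs'
      exact hs'
  have hpL : (p₁, p₂) ∈ L := by
    refine ⟨hpC, ?_⟩
    rw [hφ]
    simp only
    rw [gprod_of_mem_seg hp1]
    exact hs.2 (forall_mem_image.2 fun e he => he.2)
  have hqR : (q₁, q₂) ∈ R := by
    refine ⟨hqC, not_le.1 fun h => ?_⟩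
    have h2 := hLψ _ ⟨hqC, h⟩
    simp only [hψ, gprod_of_mem_seg hq2] at h2
    exact h2.not_ge (hr.2 (forall_mem_image.2 fun e he => hRψ e he))
  have lt1 : dist c'.1 p₁ ≤ dist c'.1 a ∧ dist c'.1 a < dist c'.1 q₁ := by
    have h1 := hpL.2
    have h2 := hqR.2
    simp only [hφ, gprod_of_mem_seg hp1, gprod_of_mem_seg hq1] at h1 h2
    exact ⟨h1, h2⟩
  have lt2 : dist c.2 q₂ ≤ dist c.2 b ∧ dist c.2 b < dist c.2 p₂ := by
    have h1 := hLψ _ hpL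
    have h2 := hRψ _ hqR
    simp only [hψ, gprod_of_mem_seg hp2, gprod_of_mem_seg hq2] at h1 h2
    exact ⟨h2, h1⟩
  have l1 := lt1.1.trans_lt lt1.2
  have l2 := lt2.1.trans_lt lt2.2
  have hdiag : IsDiag C (p₁, p₂) (q₁, q₂) := by
    refine ⟨hpC, hqC, fun h => ?_, fun h => ?_, disjoint_left.2 fun e he h => ?_,
      disjoint_left.2 fun e he h => ?_⟩
    · exact l1.ne (congrArg _ h)
    · exact l2.ne (congrArg _ h.symm)
    · obtain ⟨h1, h2⟩ := h
      simp only at h1 h2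
      rw [(hT₁.dirAt_eq_of_lt hp1 hq1 l1).1, hT₁.mem_dirAt_iff_lt_gprod hp1] at h1
      rw [(hT₂.dirAt_eq_of_lt hq2 hp2 l2).1, hT₂.mem_dirAt_iff_lt_gprod hq2] at h2
      rcases le_or_gt (φ e) (dist c'.1 a) with h | h
      · exact h1.not_ge (hs.1 ⟨e, ⟨he, h⟩, rfl⟩)
      · exact h2.not_ge (hr.1 ⟨e, ⟨he, h⟩, rfl⟩)
    · obtain ⟨h1, h2⟩ := h
      simp only at h1 h2
      rw [(hT₁.dirAt_eq_of_lt hp1 hq1 l1).2, hT₁.mem_dirAt_iff_gprod_lt hq1] at h1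
      rw [(hT₂.dirAt_eq_of_lt hq2 hp2 l2).2, hT₂.mem_dirAt_iff_gprod_lt hp2] at h2
      rcases le_or_gt (φ e) (dist c'.1 a) with h | h
      · exact h2.not_ge (hr'.1 ⟨e, ⟨he, h⟩, rfl⟩)
      · exact h1.not_ge (hs'.1 ⟨e, ⟨he, h⟩, rfl⟩)
  obtain ⟨τ, ⟨hτ0, hτ1⟩, hτ⟩ := exists_mem_iff lt1.1 lt1.2 lt2.1 lt2.2
  obtain ⟨u, hu, hu1, hu2⟩ := exists_mem_mainDiag hT₁ hT₂ (p₁, p₂) (q₁, q₂) ⟨hτ0, hτ1⟩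
  refine key u (Or.inr ⟨_, _, hdiag, hu⟩) ?_
  have g1 : φ u = dist c'.1 p₁ + τ * (dist c'.1 q₁ - dist c'.1 p₁) := by
    refine (hT₁.gprod_eq_add hp1 hq1 l1.le hu.1).trans ?_
    rw [hu1, hT₁.dist_eq_sub hp1 hq1 l1.le]
  have g2 : ψ u = dist c.2 q₂ + (1 - τ) * (dist c.2 p₂ - dist c.2 q₂) := by
    refine (hT₂.gprod_eq_add hq2 hp2 l2.le (mainDiag_symm hu).2.1).trans ?_
    rw [hu2, hT₂.dist_eq_sub hq2 hp2 l2.le]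
  change _ < φ u ↔ _ < ψ u
  rwa [g1, g2]

lemma IsCoreLike.isQuadComplement (hT₁ : IsRTree T₁) (hT₂ : IsRTree T₂) (hC : IsCoreLike C) :
    IsQuadComplement (withDiags C) where
  exists_quad _ hz := hC.exists_quad_withDiags hT₁ hT₂ hz
  exists_mem _ hne hd := hC.exists_mem_withDiags hT₁ hT₂ hne hd

end Diagonals

/-! ### The core and the augmented core -/

section CoreAction

universe u v w

section Tree

variable {G : Type u} {T : Type v} [Group G] [MetricSpace T] [MulAction G T]

lemma IsometricAction.smul_mem_seg (hiso : IsometricAction G T) (g : G) {x y z : T} :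
    g • x ∈ seg (g • y) (g • z) ↔ x ∈ seg y z := by
  simp only [mem_seg, hiso g]

lemma IsometricAction.smul_mem_dirAt (hiso : IsometricAction G T) (g : G) {x a y : T} :
    g • x ∈ dirAt a y ↔ x ∈ dirAt (g⁻¹ • a) (g⁻¹ • y) := by
  rw [mem_dirAt, mem_dirAt, ← hiso.smul_mem_seg g (x := g⁻¹ • a), smul_inv_smul, smul_inv_smul]

lemma MinimalAction.exists_smul_mem_dirAt (hT : IsRTree T) (hiso : IsometricAction G T)
    (hmin : MinimalAction G T) (c : T) {a y : T} (hy : y ≠ a) : ∃ g : G, g • c ∈ dirAt a y := by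
  by_contra! h
  have huniv := hmin {x | ∀ g : G, g • x ∉ dirAt a y} ⟨c, h⟩
    (fun x hx x' hx' z hz g => hT.treeConvex_compl_dirAt a y _ (hx g) _ (hx' g)
      ((hiso.smul_mem_seg g).2 hz))
    (fun g x hx g' => by rw [smul_smul]; exact hx _)
  have : y ∈ {x | ∀ g : G, g • x ∉ dirAt a y} := huniv ▸ mem_univ y
  exact this 1 (by rw [one_smul]; exact self_mem_dirAt hy)

lemma IsometricAction.tendsto_dist_mul_smul (hiso : IsometricAction G T) (g : G) {γ : ℕ → G}
    {p : T} (h : Tendsto (fun k => dist (γ k • p) p) atTop atTop) :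
    Tendsto (fun k => dist ((g * γ k) • p) p) atTop atTop := by
  refine tendsto_atTop_mono (fun k => ?_)
    (tendsto_atTop_add_const_right _ (-dist p (g • p)) h)
  have := dist_triangle (g • γ k • p) p (g • p)
  rw [hiso g, smul_smul] at this
  linarith

lemma openSeg_symm (x y : T) : openSeg x y = openSeg y x := by
  rw [openSeg, openSeg, seg_symm, pair_comm]

lemma mem_dirAt_of_mem_openSeg {x y z : T} (h : z ∈ openSeg x y) : z ∈ dirAt x y := by
  rw [mem_dirAt]
  intro h'
  rw [seg_symm] at h'
  refine h.2 (Or.inl ?_)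
  refine eq_of_mem_seg_of_mem_seg (p := y) ?_ h'
  rw [seg_symm]
  exact h.1

lemma IsRTree.exists_mem_openSeg_dist_lt (hT : IsRTree T) {x y : T} (hxy : x ≠ y) {ε : ℝ} (hε : 0 < ε) :
    ∃ z ∈ openSeg x y, dist x z < ε := by
  have hd := dist_pos.2 hxy
  have h1 := min_le_left (ε / 2) (dist x y / 2)
  have h2 := min_le_right (ε / 2) (dist x y / 2)
  have h0 : 0 < min (ε / 2) (dist x y / 2) := lt_min (half_pos hε) (half_pos hd)
  obtain ⟨z, hz, e1, e2⟩ := hT.exists_mem_seg x y h0.le (by linarith)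
  refine ⟨z, ⟨hz, ?_⟩, by linarith⟩
  rintro (rfl | rfl)
  · rw [dist_self] at e1; linarith
  · rw [dist_self] at e2; linarith

lemma IsRTree.left_mem_of_openSeg_subset (hT : IsRTree T) {x y : T} (hxy : x ≠ y) {S : Set T}
    (hS : IsClosed S) (h : openSeg x y ⊆ S) : x ∈ S := by
  rw [← hS.closure_eq, Metric.mem_closure_iff]
  intro ε hε
  obtain ⟨z, hz, hlt⟩ := hT.exists_mem_openSeg_dist_lt hxy hε
  exact ⟨z, h hz, hlt⟩

end Tree

variable {G : Type u} {T₁ : Type v} {T₂ : Type w} [Group G] [MetricSpace T₁] [MetricSpace T₂]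
  [MulAction G T₁] [MulAction G T₂]

lemma mem_core_iff (hT₁ : IsRTree T₁) (hT₂ : IsRTree T₂) {z : T₁ × T₂} :
    z ∈ Core G T₁ T₂ ↔ ∀ q, z ∈ quad q → Heavy G (quad q) := by
  constructor
  · intro hz q hq
    have h1 : q.2.1 ≠ q.1.1 := fun h => hq.1 (h ▸ right_mem_seg _ _)
    have h2 : q.2.2 ≠ q.1.2 := fun h => hq.2 (h ▸ right_mem_seg _ _)
    exact hz _ ⟨_, _, ⟨_, hT₁.isDirectionAt_iff.2 ⟨_, h1, rfl⟩⟩,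
      ⟨_, hT₂.isDirectionAt_iff.2 ⟨_, h2, rfl⟩⟩, rfl⟩ hq
  · rintro h _ ⟨_, _, ⟨a, ha⟩, ⟨b, hb⟩, rfl⟩ hz
    obtain ⟨α, -, rfl⟩ := hT₁.isDirectionAt_iff.1 ha
    obtain ⟨β, -, rfl⟩ := hT₂.isDirectionAt_iff.1 hb
    exact h ((a, b), (α, β)) hz

lemma smul_mem_core (hT₁ : IsRTree T₁) (hT₂ : IsRTree T₂) (hiso₁ : IsometricAction G T₁)
    (hiso₂ : IsometricAction G T₂) (g : G) {z : T₁ × T₂} (hz : z ∈ Core G T₁ T₂) :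
    (g • z.1, g • z.2) ∈ Core G T₁ T₂ := by
  rw [mem_core_iff hT₁ hT₂] at hz ⊢
  rintro ⟨⟨a, b⟩, α, β⟩ ⟨h1, h2⟩ p
  obtain ⟨γ, hγ, hγ1, hγ2⟩ := hz ((g⁻¹ • a, g⁻¹ • b), (g⁻¹ • α, g⁻¹ • β))
    ⟨(hiso₁.smul_mem_dirAt g).1 h1, (hiso₂.smul_mem_dirAt g).1 h2⟩ p
  refine ⟨fun k => g * γ k, fun k => ⟨?_, ?_⟩, hiso₁.tendsto_dist_mul_smul g hγ1,
    hiso₂.tendsto_dist_mul_smul g hγ2⟩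
  · simp only [mul_smul]
    exact (hiso₁.smul_mem_dirAt g).2 (hγ k).1
  · simp only [mul_smul]
    exact (hiso₂.smul_mem_dirAt g).2 (hγ k).2

lemma not_heavy_iff (hT₁ : IsRTree T₁) (hT₂ : IsRTree T₂) (hiso₁ : IsometricAction G T₁)
    (hiso₂ : IsometricAction G T₂) (hne : (Core G T₁ T₂).Nonempty) (a α : T₁) (b β : T₂) :
    ¬ Heavy G (dirAt a α ×ˢ dirAt b β) ↔ Disjoint (Core G T₁ T₂) (dirAt a α ×ˢ dirAt b β) := by
  constructor
  · exact fun h => disjoint_left.2 fun z hz hzQ =>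
      h ((mem_core_iff hT₁ hT₂).1 hz ((a, b), (α, β)) hzQ)
  · intro h hh
    obtain ⟨c, hc⟩ := hne
    obtain ⟨γ, hγ, -⟩ := hh c
    exact disjoint_left.1 h (smul_mem_core hT₁ hT₂ hiso₁ hiso₂ (γ 0) hc) (hγ 0)

lemma isCoreLike_core (hT₁ : IsRTree T₁) (hT₂ : IsRTree T₂) (hiso₁ : IsometricAction G T₁)
    (hiso₂ : IsometricAction G T₂) (hmin₁ : MinimalAction G T₁) (hmin₂ : MinimalAction G T₂)
    (hne : (Core G T₁ T₂).Nonempty) : IsCoreLike (Core G T₁ T₂) where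
  exists_quad z hz := by
    rw [mem_core_iff hT₁ hT₂] at hz
    push Not at hz
    obtain ⟨q, hq, hl⟩ := hz
    exact ⟨q, hq, (not_heavy_iff hT₁ hT₂ hiso₁ hiso₂ hne _ _ _ _).1 hl⟩
  exists_fst a y hy := by
    obtain ⟨c, hc⟩ := hne
    obtain ⟨g, hg⟩ := hmin₁.exists_smul_mem_dirAt hT₁ hiso₁ c.1 hy
    exact ⟨_, smul_mem_core hT₁ hT₂ hiso₁ hiso₂ g hc, hg⟩
  exists_snd a y hy := by
    obtain ⟨c, hc⟩ := hne
    obtain ⟨g, hg⟩ := hmin₂.exists_smul_mem_dirAt hT₂ hiso₂ c.2 hy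
    exact ⟨_, smul_mem_core hT₁ hT₂ hiso₁ hiso₂ g hc, hg⟩

lemma IsRTree.facing_iff {T : Type*} [MetricSpace T] (hT : IsRTree T) {x x' : T} (h : x ≠ x')
    {δ δ' : Set T} : IsDirectionAt δ x ∧ IsDirectionAt δ' x' ∧ FacingDirections δ δ' ↔
      δ = dirAt x x' ∧ δ' = dirAt x' x := by
  rw [hT.isDirectionAt_iff, hT.isDirectionAt_iff]
  constructor
  · rintro ⟨⟨y, -, rfl⟩, ⟨y', -, rfl⟩, hf⟩
    refine ⟨(hT.dirAt_eq (x := x') ?_).symm, (hT.dirAt_eq (x := x) ?_).symm⟩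
    · exact (hf ▸ mem_univ x').resolve_right fun k => k (left_mem_seg _ _)
    · exact (hf ▸ mem_univ x).resolve_left fun k => k (left_mem_seg _ _)
  · rintro ⟨rfl, rfl⟩
    exact ⟨⟨_, h.symm, rfl⟩, ⟨_, h, rfl⟩, eq_univ_of_forall fun e => mem_dirAt_or h e⟩

lemma isTwiceLightRect_iff (hT₁ : IsRTree T₁) (hT₂ : IsRTree T₂) (hiso₁ : IsometricAction G T₁)
    (hiso₂ : IsometricAction G T₂) (hne : (Core G T₁ T₂).Nonempty) {x x' : T₁ × T₂} :
    IsTwiceLightRect G x x' ↔ x.1 ≠ x'.1 ∧ x.2 ≠ x'.2 ∧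
      Disjoint (Core G T₁ T₂) (dirAt x.1 x'.1 ×ˢ dirAt x.2 x'.2) ∧
      Disjoint (Core G T₁ T₂) (dirAt x'.1 x.1 ×ˢ dirAt x'.2 x.2) := by
  have hl := not_heavy_iff hT₁ hT₂ hiso₁ hiso₂ hne
  constructor
  · rintro ⟨δ₁, δ₂, δ₁', δ₂', h1, h2, h1', h2', n1, n2, f1, f2, l, l'⟩
    obtain ⟨rfl, rfl⟩ := (hT₁.facing_iff n1).1 ⟨h1, h1', f1⟩
    obtain ⟨rfl, rfl⟩ := (hT₂.facing_iff n2).1 ⟨h2, h2', f2⟩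
    exact ⟨n1, n2, (hl _ _ _ _).1 l, (hl _ _ _ _).1 l'⟩
  · rintro ⟨n1, n2, l, l'⟩
    obtain ⟨h1, h1', f1⟩ := (hT₁.facing_iff n1).2 ⟨rfl, rfl⟩
    obtain ⟨h2, h2', f2⟩ := (hT₂.facing_iff n2).2 ⟨rfl, rfl⟩
    exact ⟨_, _, _, _, h1, h2, h1', h2', n1, n2, f1, f2, (hl _ _ _ _).2 l, (hl _ _ _ _).2 l'⟩

/-- Nested open segments are equal if the endpoints of the first are not in the second. -/
lemma IsRTree.openSeg_eq {T : Type*} [MetricSpace T] (hT : IsRTree T) {x x' y y' : T}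
    (hx : x ≠ x') (h : openSeg x x' ⊆ openSeg y y') (h1 : x ∉ openSeg y y')
    (h2 : x' ∉ openSeg y y') : openSeg x x' = openSeg y y' := by
  have hseg := h.trans sdiff_subset
  have k1 : x ∈ ({y, y'} : Set T) := by
    by_contra hc
    exact h1 ⟨hT.left_mem_of_openSeg_subset hx (isClosed_seg _ _) hseg, hc⟩
  have k2 : x' ∈ ({y, y'} : Set T) := by
    by_contra hc
    exact h2 ⟨hT.left_mem_of_openSeg_subset hx.symm (isClosed_seg _ _) (openSeg_symm x x' ▸ hseg), hc⟩
  rcases k1 with rfl | rfl <;> rcases k2 with rfl | rfl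
  · exact absurd rfl hx
  · rfl
  · exact openSeg_symm _ _
  · exact absurd rfl hx

lemma IsDiag.isMaxTwiceLightRect (hT₁ : IsRTree T₁) (hT₂ : IsRTree T₂)
    (hiso₁ : IsometricAction G T₁) (hiso₂ : IsometricAction G T₂)
    {p q : T₁ × T₂} (h : IsDiag (Core G T₁ T₂) p q) :
    IsMaxTwiceLightRect G (p.1, q.2) (q.1, p.2) := by
  have hne : (Core G T₁ T₂).Nonempty := ⟨p, h.left⟩
  refine ⟨(isTwiceLightRect_iff hT₁ hT₂ hiso₁ hiso₂ hne).2
    ⟨h.fst_ne, h.snd_ne.symm, h.disj, h.disj'⟩, fun y y' hy hsub => ?_⟩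
  obtain ⟨n1, n2, d, d'⟩ := (isTwiceLightRect_iff hT₁ hT₂ hiso₁ hiso₂ hne).1 hy
  obtain ⟨z₁, hz₁, -⟩ := hT₁.exists_mem_openSeg_dist_lt h.fst_ne one_pos
  obtain ⟨z₂, hz₂, -⟩ := hT₂.exists_mem_openSeg_dist_lt h.snd_ne.symm one_pos
  have s1 : openSeg p.1 q.1 ⊆ openSeg y.1 y'.1 := fun e he => (hsub (mk_mem_prod he hz₂)).1
  have s2 : openSeg q.2 p.2 ⊆ openSeg y.2 y'.2 := fun e he => (hsub (mk_mem_prod hz₁ he)).2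
  have c1 : ∀ e ∈ Core G T₁ T₂, e.1 ∉ openSeg y.1 y'.1 := fun e he k =>
    (mem_dirAt_or n2 e.2).elim
      (fun k' => disjoint_left.1 d he ⟨mem_dirAt_of_mem_openSeg k, k'⟩)
      (fun k' => disjoint_left.1 d' he
        ⟨mem_dirAt_of_mem_openSeg (openSeg_symm y.1 y'.1 ▸ k), k'⟩)
  have c2 : ∀ e ∈ Core G T₁ T₂, e.2 ∉ openSeg y.2 y'.2 := fun e he k =>
    (mem_dirAt_or n1 e.1).elim
      (fun k' => disjoint_left.1 d he ⟨k', mem_dirAt_of_mem_openSeg k⟩)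
      (fun k' => disjoint_left.1 d' he
        ⟨k', mem_dirAt_of_mem_openSeg (openSeg_symm y.2 y'.2 ▸ k)⟩)
  exact congrArg₂ (· ×ˢ ·) (hT₁.openSeg_eq h.fst_ne s1 (c1 p h.left) (c1 q h.right))
    (hT₂.openSeg_eq h.snd_ne.symm s2 (c2 q h.right) (c2 p h.left))

lemma IsTwiceLightRect.isDiag (hT₁ : IsRTree T₁) (hT₂ : IsRTree T₂)
    (hiso₁ : IsometricAction G T₁) (hiso₂ : IsometricAction G T₂) {x x' p q : T₁ × T₂}
    (h : IsTwiceLightRect G x x') (hp : p ∈ Core G T₁ T₂) (hq : q ∈ Core G T₁ T₂)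
    (h1 : ({p.1, q.1} : Set T₁) = {x.1, x'.1}) (h2 : ({p.2, q.2} : Set T₂) = {x.2, x'.2}) :
    IsDiag (Core G T₁ T₂) p q := by
  obtain ⟨n1, n2, d, d'⟩ := (isTwiceLightRect_iff hT₁ hT₂ hiso₁ hiso₂ ⟨p, hp⟩).1 h
  obtain ⟨x₁, x₂⟩ := x
  obtain ⟨x₁', x₂'⟩ := x'
  obtain ⟨p₁, p₂⟩ := p
  obtain ⟨q₁, q₂⟩ := q
  rcases pair_eq_pair_iff.1 h1 with ⟨e1, e1'⟩ | ⟨e1, e1'⟩ <;>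
  rcases pair_eq_pair_iff.1 h2 with ⟨e2, e2'⟩ | ⟨e2, e2'⟩ <;>
  simp only at e1 e1' e2 e2' n1 n2 d d' <;> subst e1 e1' e2 e2'
  · exact absurd ⟨self_mem_dirAt n1.symm, self_mem_dirAt n2.symm⟩ (disjoint_left.1 d hq)
  · exact ⟨hp, hq, n1, n2.symm, d, d'⟩
  · exact ⟨hp, hq, n1.symm, n2, d', d⟩
  · exact absurd ⟨self_mem_dirAt n1.symm, self_mem_dirAt n2.symm⟩ (disjoint_left.1 d hp)

lemma augCore_eq (hT₁ : IsRTree T₁) (hT₂ : IsRTree T₂) (hiso₁ : IsometricAction G T₁)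
    (hiso₂ : IsometricAction G T₂) : AugCore G T₁ T₂ = withDiags (Core G T₁ T₂) := by
  refine congrArg (Core G T₁ T₂ ∪ ·) (ext fun z => ⟨?_, ?_⟩)
  · rintro ⟨x, x', p, q, h, hp, hq, h1, h2, -, -, hz⟩
    exact ⟨p, q, h.1.isDiag hT₁ hT₂ hiso₁ hiso₂ hp hq h1 h2, hz⟩
  · rintro ⟨p, q, h, hz⟩
    exact ⟨_, _, p, q, h.isMaxTwiceLightRect hT₁ hT₂ hiso₁ hiso₂, h.left, h.right, rfl,
      pair_comm _ _, h.fst_ne, h.snd_ne, hz⟩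

end CoreAction

/-- Proposition 5.10: for minimal actions with non-empty core, the
augmented core endowed with the path metric induced by the `ℓ²` product metric is a
CAT(0) space. -/
theorem augmented_core_CAT0
    {G T₁ T₂ : Type*} [Group G] [MetricSpace T₁] [MetricSpace T₂]
    [MulAction G T₁] [MulAction G T₂]
    (hT₁ : IsRTree T₁) (hT₂ : IsRTree T₂)
    (hiso₁ : IsometricAction G T₁) (hiso₂ : IsometricAction G T₂)
    (hmin₁ : MinimalAction G T₁) (hmin₂ : MinimalAction G T₂)
    (hne : (Core G T₁ T₂).Nonempty) :
    IsCAT0Dist (pathDistOn (AugCore G T₁ T₂)) := by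
  rw [augCore_eq hT₁ hT₂ hiso₁ hiso₂]
  obtain ⟨m⟩ := ((isCoreLike_core hT₁ hT₂ hiso₁ hiso₂ hmin₁ hmin₂ hne).isQuadComplement
    hT₁ hT₂).nonempty_model hT₁ hT₂
  exact m.isCAT0Dist

end Guirardel
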